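/- arXiv:1805.05104 — 9 statements merged into one kernel-verified Lean document; each statement's English description precedes it below -/
import Mathlib

section
/- Let A be a (possibly nonassociative) algebra over a field K of characteristic zero, let B = A ⊕ A with componentwise operations, and let ψ be an algebra automorphism of A. Then the linear map R on B defined by R((a₁, a₂)) = (0, ψ(a₁)) is a Rota–Baxter operator on B of weight 1, and the linear map R' on B defined by R'((a₁, a₂)) = (−a₁, −ψ(a₁)) is also a Rota–Baxter operator on B of weight 1. -/
/-- A Rota–Baxter operator of weight `lam` on a (possibly nonassociative)
`K`-algebra `A`. -/
def IsRBOp (K : Type*) {A : Type*} [Field K] [CharZero K] [NonUnitalNonAssocRing A]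
    [Module K A] [SMulCommClass K A A] [IsScalarTower K A A]
    (R : A →ₗ[K] A) (lam : K) : Prop :=
  ∀ x y : A, R x * R y = R (R x * y + x * R y + lam • (x * y))

theorem rb_on_double (K : Type*) {A : Type*} [Field K] [CharZero K]
    [NonUnitalNonAssocRing A] [Module K A] [SMulCommClass K A A] [IsScalarTower K A A]
    (ψ : A ≃ₗ[K] A) (hψ : ∀ x y : A, ψ (x * y) = ψ x * ψ y)
    (R R' : A × A →ₗ[K] A × A)
    (hR : ∀ a : A × A, R a = (0, ψ a.1))
    (hR' : ∀ a : A × A, R' a = (-a.1, -ψ a.1)) :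
    IsRBOp K R 1 ∧ IsRBOp K R' 1 := by
  refine ⟨fun x y => ?_, fun x y => ?_⟩
  · simp [hR, hψ]
  · simp [hR', hψ]
end

section
/- Let A be a (possibly nonassociative) algebra over a field K of characteristic zero and R a Rota–Baxter operator on A of nonzero weight λ. Then R is split if and only if R ∘ (R + λ·id) = 0. -/
/-- An operator `R` is split (with weight `lam`) if `A = A₁ ∔ A₂` is a direct vector
space sum of two subalgebras and `R (a₁ + a₂) = -lam • a₂` for `a₁ ∈ A₁`, `a₂ ∈ A₂`. -/
def IsSplitRB (K : Type*) {A : Type*} [Field K] [CharZero K] [NonUnitalNonAssocRing A]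
    [Module K A] [SMulCommClass K A A] [IsScalarTower K A A]
    (R : A →ₗ[K] A) (lam : K) : Prop :=
  ∃ A₁ A₂ : Submodule K A,
    (∀ x ∈ A₁, ∀ y ∈ A₁, x * y ∈ A₁) ∧
    (∀ x ∈ A₂, ∀ y ∈ A₂, x * y ∈ A₂) ∧
    IsCompl A₁ A₂ ∧
    ∀ x ∈ A₁, ∀ y ∈ A₂, R (x + y) = -(lam • y)

theorem rb_split_iff (K : Type*) {A : Type*} [Field K] [CharZero K]
    [NonUnitalNonAssocRing A] [Module K A] [SMulCommClass K A A] [IsScalarTower K A A]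
    (lam : K) (hlam : lam ≠ 0) (R : A →ₗ[K] A) (hR : IsRBOp K R lam) :
    IsSplitRB K R lam ↔ R ∘ₗ (R + lam • LinearMap.id) = 0 := by
  have comp_eq_zero_iff : R ∘ₗ (R + lam • LinearMap.id) = 0 ↔ ∀ x, R (R x) = -(lam • R x) := by
    simp [LinearMap.ext_iff, eq_neg_iff_add_eq_zero]
  rw [comp_eq_zero_iff]
  constructor
  · rintro ⟨A₁, A₂, -, -, hcompl, hsplit⟩ x
    obtain ⟨a, ha, b, hb, rfl⟩ :=
      Submodule.mem_sup.mp (hcompl.sup_eq_top ▸ Submodule.mem_top : x ∈ A₁ ⊔ A₂)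
    have hRb : R b = -(lam • b) := by simpa using hsplit 0 A₁.zero_mem b hb
    rw [hsplit a ha b hb, map_neg, map_smul, hRb]
  · intro h
    refine ⟨LinearMap.ker R, LinearMap.range R, ?_, ?_, ⟨?_, ?_⟩, ?_⟩
    · intro x hx y hy
      rw [LinearMap.mem_ker] at hx hy ⊢
      simpa [hx, hy, hlam] using (hR x y).symm
    · rintro _ ⟨x, rfl⟩ _ ⟨y, rfl⟩
      exact ⟨_, (hR x y).symm⟩
    · rw [Submodule.disjoint_def]
      rintro _ hx ⟨y, rfl⟩
      rw [LinearMap.mem_ker, h y] at hx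
      simpa [hlam] using hx
    · rw [codisjoint_iff, Submodule.eq_top_iff']
      intro x
      refine Submodule.mem_sup.mpr
        ⟨x + lam⁻¹ • R x, ?_, -(lam⁻¹ • R x), ⟨-(lam⁻¹ • x), by simp⟩, by simp⟩
      simp [LinearMap.mem_ker, h, hlam]
    · rintro x hx _ ⟨y, rfl⟩
      rw [map_add, LinearMap.mem_ker.mp hx, h, zero_add]
end

section
/- Let n = (V, {·,·}) be a Lie algebra over a field K of characteristic zero and let R be a Rota–Baxter operator of weight 1 on n. Then the induced bracket [x,y] := {R(x), y} − {R(y), x} + {x, y} defines a Lie algebra structure g on V, and the product x·y := {R(x), y} is a post-Lie algebra structure on the pair (g, n). -/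
/-- A Lie bracket on the `K`-vector space `V`, given as a plain binary product:
it is `K`-bilinear, alternating, and satisfies the Jacobi identity
(in Leibniz form). -/
def IsLieBr (K : Type*) {V : Type*} [Field K] [CharZero K] [AddCommGroup V] [Module K V]
    (b : V → V → V) : Prop :=
  (∀ x : V, IsLinearMap K (b x)) ∧ (∀ y : V, IsLinearMap K fun x => b x y) ∧
  (∀ x : V, b x x = 0) ∧ ∀ x y z : V, b x (b y z) = b (b x y) z + b y (b x z)

/-- A Rota–Baxter operator of weight `lam` on the Lie algebra `(V, b)`. -/
def IsLieRB (K : Type*) {V : Type*} [Field K] [CharZero K] [AddCommGroup V] [Module K V]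
    (b : V → V → V) (R : V →ₗ[K] V) (lam : K) : Prop :=
  ∀ x y : V, b (R x) (R y) = R (b (R x) y + b x (R y) + lam • b x y)

/-- The bracket `[x,y] = {R x, y} - {R y, x} + {x, y}` induced by an operator `R`
on a Lie algebra `(V, b)`. -/
def indBr {K V : Type*} [Field K] [CharZero K] [AddCommGroup V] [Module K V]
    (b : V → V → V) (R : V →ₗ[K] V) : V → V → V :=
  fun x y => b (R x) y - b (R y) x + b x y

/-- A post-Lie algebra structure on the pair of Lie algebras `(V, gb)` and `(V, nb)`:
a bilinear product `mul` with `x·y - y·x = [x,y] - {x,y}`, `[x,y]·z = x·(y·z) - y·(x·z)`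
and `x·{y,z} = {x·y, z} + {y, x·z}`. -/
def IsPostLie (K : Type*) {V : Type*} [Field K] [CharZero K] [AddCommGroup V] [Module K V]
    (gb nb mul : V → V → V) : Prop :=
  (∀ x : V, IsLinearMap K (mul x)) ∧ (∀ y : V, IsLinearMap K fun x => mul x y) ∧
  (∀ x y : V, mul x y - mul y x = gb x y - nb x y) ∧
  (∀ x y z : V, mul (gb x y) z = mul x (mul y z) - mul y (mul x z)) ∧
  (∀ x y z : V, mul x (nb y z) = nb (mul x y) z + nb y (mul x z))

theorem IsLieBr.skew {K V : Type*} [Field K] [CharZero K] [AddCommGroup V] [Module K V]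
    {b : V → V → V} (hb : IsLieBr K b) (x y : V) : b x y = -b y x := by
  obtain ⟨hr, hl, halt, -⟩ := hb
  have h := halt (x + y)
  rw [(hr (x + y)).map_add, (hl x).map_add, (hl y).map_add, halt, halt] at h
  simp only [zero_add, add_zero] at h
  exact eq_neg_of_add_eq_zero_right h

theorem IsLieBr.indBr_apply {K V : Type*} [Field K] [CharZero K] [AddCommGroup V] [Module K V]
    {b : V → V → V} (hb : IsLieBr K b) (R : V →ₗ[K] V) (x y : V) :
    indBr b R x y = b (R x) y + b x (R y) + b x y := by
  rw [indBr, hb.skew (R y) x, sub_neg_eq_add]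

theorem IsLieRB.map_indBr {K V : Type*} [Field K] [CharZero K] [AddCommGroup V] [Module K V]
    {b : V → V → V} (hb : IsLieBr K b) {R : V →ₗ[K] V} (hR : IsLieRB K b R 1) (x y : V) :
    R (indBr b R x y) = b (R x) (R y) := by
  rw [hb.indBr_apply, hR, one_smul]

theorem IsLieRB.isLieBr_indBr {K V : Type*} [Field K] [CharZero K] [AddCommGroup V]
    [Module K V] {b : V → V → V} (hb : IsLieBr K b) {R : V →ₗ[K] V}
    (hR : IsLieRB K b R 1) : IsLieBr K (indBr b R) := by
  obtain ⟨hr, hl, halt, hj⟩ := id hb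
  have radd (x y z : V) : b x (y + z) = b x y + b x z := (hr x).map_add y z
  have ladd (x y z : V) : b (x + y) z = b x z + b y z := (hl z).map_add x y
  have rsmul (c : K) (x y : V) : b x (c • y) = c • b x y := (hr x).map_smul c y
  have lsmul (c : K) (x y : V) : b (c • x) y = c • b x y := (hl y).map_smul c x
  refine ⟨fun x => ⟨fun y z => ?_, fun c y => ?_⟩, fun y => ⟨fun x z => ?_, fun c x => ?_⟩,
    fun x => ?_, fun x y z => ?_⟩
  · simp only [hb.indBr_apply, map_add, radd]
    abel
  · simp only [hb.indBr_apply, map_smul, rsmul, smul_add]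
  · simp only [hb.indBr_apply, map_add, ladd]
    abel
  · simp only [hb.indBr_apply, map_smul, lsmul, smul_add]
  · simp [indBr, halt]
  · rw [hb.indBr_apply R x (indBr b R y z), hb.indBr_apply R (indBr b R x y) z,
      hb.indBr_apply R y (indBr b R x z)]
    simp only [hR.map_indBr hb]
    simp only [hb.indBr_apply, radd, ladd]
    rw [hj (R x) (R y) z, hj (R x) y (R z), hj (R x) y z, hj x (R y) (R z), hj x (R y) z,
      hj x y (R z), hj x y z]
    abel

theorem rb_gives_postLie (K : Type*) {V : Type*} [Field K] [CharZero K]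
    [AddCommGroup V] [Module K V]
    (nb : V → V → V) (hn : IsLieBr K nb)
    (R : V →ₗ[K] V) (hR : IsLieRB K nb R 1) :
    IsLieBr K (indBr nb R) ∧
      IsPostLie K (indBr nb R) nb (fun x y => nb (R x) y) := by
  obtain ⟨hr, hl, -, hj⟩ := id hn
  refine ⟨hR.isLieBr_indBr hn, fun x => hr (R x), fun y => ⟨fun x z => ?_, fun c x => ?_⟩,
    fun x y => ?_, fun x y z => ?_, fun x y z => hj (R x) y z⟩
  · simpa only [map_add] using (hl y).map_add (R x) (R z)
  · simpa only [map_smul] using (hl y).map_smul c (R x)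
  · simp only [indBr, add_sub_cancel_right]
  · simp only [hR.map_indBr hn, hj (R x) (R y) z, add_sub_cancel_right]
end

section
/- Let n = (V, {·,·}) be a Lie algebra over a field K of characteristic zero with trivial center, let g = (V, [·,·]) be another Lie algebra structure on V, and suppose x·y = {φ(x), y} is a post-Lie algebra structure on (g, n) for some K-linear map φ : V → V. Then φ is a Rota–Baxter operator of weight 1 on n. Furthermore, if n is complete, then every post-Lie algebra structure on (g, n) is inner, i.e., of the form x·y = {φ(x), y} for some K-linear map φ : V → V. -/
/-- A derivation of the Lie algebra `(V, b)`. -/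
def IsLieDer (K : Type*) {V : Type*} [Field K] [CharZero K] [AddCommGroup V] [Module K V]
    (b : V → V → V) (D : V →ₗ[K] V) : Prop :=
  ∀ x y : V, D (b x y) = b (D x) y + b x (D y)

/-- A Lie algebra `(V, b)` is complete if it has trivial center and every
derivation is inner. -/
def IsCompleteLie (K : Type*) {V : Type*} [Field K] [CharZero K] [AddCommGroup V] [Module K V]
    (b : V → V → V) : Prop :=
  (∀ x : V, (∀ y : V, b x y = 0) → x = 0) ∧
  ∀ D : V →ₗ[K] V, IsLieDer K b D → ∃ z : V, ∀ x : V, D x = b z x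

section

variable {K V : Type*} [Field K] [CharZero K] [AddCommGroup V] [Module K V] {b : V → V → V}

/-- The adjoint representation of a Lie algebra with trivial center is faithful. -/
theorem IsLieBr.eq_of_forall_left (h : IsLieBr K b) (hZ : ∀ x : V, (∀ y : V, b x y = 0) → x = 0)
    {u v : V} (huv : ∀ z, b u z = b v z) : u = v :=
  sub_eq_zero.mp <| hZ _ fun z => by
    rw [(h.2.1 z).map_sub, huv, sub_self]

theorem IsLieBr.antisymm (h : IsLieBr K b) (x y : V) : b x y = -b y x := by
  have hxy := h.2.2.1 (x + y)
  rw [(h.1 (x + y)).map_add, (h.2.1 x).map_add, (h.2.1 y).map_add, h.2.2.1, h.2.2.1] at hxy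
  rw [eq_neg_iff_add_eq_zero]
  simpa [add_comm] using hxy

/-- If the center is trivial, an operator defining an inner post-Lie structure is a
Rota–Baxter operator of weight `1`. -/
theorem IsPostLie.isLieRB {gb : V → V → V} (h : IsLieBr K b)
    (hZ : ∀ x : V, (∀ y : V, b x y = 0) → x = 0) {φ : V →ₗ[K] V}
    (hφ : IsPostLie K gb b fun x y => b (φ x) y) : IsLieRB K b φ 1 := by
  obtain ⟨-, -, hsub, hact, -⟩ := hφ
  intro x y
  have hgb : b (φ x) y + b x (φ y) + (1 : K) • b x y = gb x y := by
    rw [one_smul, h.antisymm x (φ y), ← sub_eq_add_neg, hsub, sub_add_cancel]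
  rw [hgb]
  exact h.eq_of_forall_left hZ fun z => by
    rw [eq_sub_of_add_eq (h.2.2.2 (φ x) (φ y) z).symm]
    exact (hact x y z).symm

/-- Every post-Lie structure on a pair whose second Lie algebra is complete is inner. -/
theorem IsPostLie.exists_inner {gb mul : V → V → V} (h : IsLieBr K b) (hc : IsCompleteLie K b)
    (hmul : IsPostLie K gb b mul) : ∃ φ : V →ₗ[K] V, ∀ x y : V, mul x y = b (φ x) y := by
  obtain ⟨hright, hleft, -, -, hder⟩ := hmul
  choose f hf using fun x => hc.2 (hright x).mk' (hder x)
  replace hf : ∀ x y, mul x y = b (f x) y := hf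
  refine ⟨{ toFun := f, map_add' := fun x y => ?_, map_smul' := fun c x => ?_ }, hf⟩
  · exact h.eq_of_forall_left hc.1 fun z => by
      rw [← hf, (hleft z).map_add, (h.2.1 z).map_add, hf, hf]
  · exact h.eq_of_forall_left hc.1 fun z => by
      rw [← hf, (hleft z).map_smul, RingHom.id_apply, (h.2.1 z).map_smul, hf]

end

theorem inner_postLie_gives_rb (K : Type*) {V : Type*} [Field K] [CharZero K]
    [AddCommGroup V] [Module K V]
    (nb gb : V → V → V) (hn : IsLieBr K nb) (hg : IsLieBr K gb)
    (hZ : ∀ x : V, (∀ y : V, nb x y = 0) → x = 0) :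
    (∀ φ : V →ₗ[K] V, IsPostLie K gb nb (fun x y => nb (φ x) y) → IsLieRB K nb φ 1) ∧
    (IsCompleteLie K nb →
      ∀ mul : V → V → V, IsPostLie K gb nb mul →
        ∃ φ : V →ₗ[K] V, ∀ x y : V, mul x y = nb (φ x) y) := by
  exact ⟨fun _ hφ => hφ.isLieRB hn hZ, fun hc _ hmul => hmul.exists_inner hn hc⟩
end

section
/- Let n = (V, {·,·}) be a complete Lie algebra over a field K of characteristic zero. Then the assignment sending a Rota–Baxter operator R of weight 1 on n to the pair consisting of the induced bracket [x,y] := {R(x), y} − {R(y), x} + {x, y} and the product x·y := {R(x), y} is a bijection between the set of Rota–Baxter operators of weight 1 on n and the set of all pairs (g, ·) where g = (V, [·,·]) is a Lie algebra structure on V and x·y is a post-Lie algebra structure on (g, n). -/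
namespace IsLieBr

variable {K V : Type*} [Field K] [CharZero K] [AddCommGroup V] [Module K V] {b : V → V → V}

lemma add_right (h : IsLieBr K b) (x y z : V) : b x (y + z) = b x y + b x z :=
  (h.1 x).map_add y z

lemma add_left (h : IsLieBr K b) (x y z : V) : b (x + y) z = b x z + b y z :=
  (h.2.1 z).map_add x y

lemma smul_right (h : IsLieBr K b) (c : K) (x y : V) : b x (c • y) = c • b x y :=
  (h.1 x).map_smul c y

lemma smul_left (h : IsLieBr K b) (c : K) (x y : V) : b (c • x) y = c • b x y :=
  (h.2.1 y).map_smul c x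

lemma sub_right (h : IsLieBr K b) (x y z : V) : b x (y - z) = b x y - b x z :=
  (h.1 x).map_sub y z

lemma sub_left (h : IsLieBr K b) (x y z : V) : b (x - y) z = b x z - b y z :=
  (h.2.1 z).map_sub x y

lemma self (h : IsLieBr K b) (x : V) : b x x = 0 := h.2.2.1 x

lemma jacobi (h : IsLieBr K b) (x y z : V) : b x (b y z) = b (b x y) z + b y (b x z) :=
  h.2.2.2 x y z

lemma skew_s8 (h : IsLieBr K b) (x y : V) : -b y x = b x y := by
  have hxy := h.self (x + y)
  rw [h.add_left, h.add_right, h.add_right, h.self, h.self, zero_add, add_zero] at hxy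
  exact (eq_neg_of_add_eq_zero_left hxy).symm

lemma lie_lie (h : IsLieBr K b) (x y z : V) : b (b x y) z = b x (b y z) - b y (b x z) := by
  rw [h.jacobi x y z, add_sub_cancel_right]

/-- An element of a centerless Lie algebra is determined by its adjoint action. -/
lemma eq_of_ad_eq (h : IsLieBr K b) (hz : ∀ x : V, (∀ y : V, b x y = 0) → x = 0)
    {x y : V} (hxy : ∀ z, b x z = b y z) : x = y :=
  sub_eq_zero.1 <| hz _ fun z => by rw [h.sub_left, hxy, sub_self]

/-- A Rota–Baxter operator of weight one maps the induced bracket to the original one. -/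
lemma map_indBr (h : IsLieBr K b) {R : V →ₗ[K] V} (hR : IsLieRB K b R 1) (x y : V) :
    R (indBr b R x y) = b (R x) (R y) := by
  rw [hR x y, one_smul, indBr, ← h.skew_s8 x (R y), sub_eq_add_neg]

lemma indBr_isLieBr (h : IsLieBr K b) {R : V →ₗ[K] V} (hR : IsLieRB K b R 1) :
    IsLieBr K (indBr b R) := by
  refine ⟨fun x => ⟨fun y z => ?_, fun c y => ?_⟩, fun x => ⟨fun y z => ?_, fun c y => ?_⟩,
    fun x => ?_, fun x y z => ?_⟩
  · simp only [indBr, map_add, h.add_left, h.add_right]; abel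
  · simp only [indBr, map_smul, h.smul_left, h.smul_right]; module
  · simp only [indBr, map_add, h.add_left, h.add_right]; abel
  · simp only [indBr, map_smul, h.smul_left, h.smul_right]; module
  · simp [indBr, h.self]
  · have key : ∀ u v, indBr b R u v = b (R u) v - b (R v) u + b u v := fun _ _ => rfl
    rw [key x, key (indBr b R x y), key y (indBr b R x z), h.map_indBr hR, h.map_indBr hR,
      h.map_indBr hR]
    simp only [key, h.add_left, h.add_right, h.sub_left, h.sub_right, h.lie_lie]
    have hzxy : b (R z) (b x y) = -b y (b (R z) x) + b x (b (R z) y) := by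
      rw [h.skew_s8, ← h.jacobi]
    rw [hzxy]
    abel

lemma indBr_isPostLie (h : IsLieBr K b) {R : V →ₗ[K] V} (hR : IsLieRB K b R 1) :
    IsPostLie K (indBr b R) b (fun x y => b (R x) y) := by
  refine ⟨fun x => h.1 (R x), fun y => ⟨fun u v => ?_, fun c u => ?_⟩, fun x y => ?_,
    fun x y z => ?_, fun x y z => h.jacobi _ _ _⟩
  · simp only [map_add, h.add_left]
  · simp only [map_smul, h.smul_left]
  · rw [indBr, add_sub_cancel_right]
  · simp only [h.map_indBr hR, h.lie_lie]

end IsLieBr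

/-- For a complete Lie algebra `n = (V, nb)`, the assignment
`R ↦ (indBr nb R, (x, y) ↦ {R x, y})` is a bijection between Rota–Baxter operators
of weight `1` on `n` and pairs `(g, ·)` of a Lie algebra structure `g` on `V`
together with a post-Lie algebra structure on `(g, n)`: it is well defined
(every RB-operator yields such a pair), and every such pair arises from a
unique RB-operator. -/
theorem rb_postLie_bijection (K : Type*) {V : Type*} [Field K] [CharZero K]
    [AddCommGroup V] [Module K V]
    (nb : V → V → V) (hn : IsLieBr K nb) (hc : IsCompleteLie K nb) :
    (∀ R : V →ₗ[K] V, IsLieRB K nb R 1 →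
      IsLieBr K (indBr nb R) ∧ IsPostLie K (indBr nb R) nb (fun x y => nb (R x) y)) ∧
    (∀ gb mul : V → V → V, IsLieBr K gb → IsPostLie K gb nb mul →
      ∃! R : V →ₗ[K] V, IsLieRB K nb R 1 ∧
        (∀ x y : V, gb x y = indBr nb R x y) ∧
        (∀ x y : V, mul x y = nb (R x) y)) := by
  refine ⟨fun R hR => ⟨hn.indBr_isLieBr hR, hn.indBr_isPostLie hR⟩, ?_⟩
  rintro gb mul - ⟨hm₁, hm₂, hcomm, hact, hder⟩
  choose r hr using fun x => hc.2 (hm₁ x).mk' (hder x)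
  have hr : ∀ x y, mul x y = nb (r x) y := hr
  let R : V →ₗ[K] V :=
    { toFun := r
      map_add' := fun x y => hn.eq_of_ad_eq hc.1 fun z => by
        rw [hn.add_left, ← hr, ← hr, ← hr]; exact (hm₂ z).map_add x y
      map_smul' := fun c x => hn.eq_of_ad_eq hc.1 fun z => by
        rw [RingHom.id_apply, hn.smul_left, ← hr, ← hr]; exact (hm₂ z).map_smul c x }
  have hR : ∀ x y, mul x y = nb (R x) y := hr
  have hg : ∀ x y, gb x y = indBr nb R x y := fun x y => by
    rw [indBr, ← hR, ← hR, hcomm, sub_add_cancel]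
  refine ⟨R, ⟨fun x y => ?_, hg, hR⟩, fun S hS => ?_⟩
  · have hxy : nb (R x) y + nb x (R y) + (1 : K) • nb x y = gb x y := by
      rw [hg, indBr, one_smul, ← hn.skew_s8 x (R y), sub_eq_add_neg]
    rw [hxy]
    refine hn.eq_of_ad_eq hc.1 fun z => ?_
    rw [hn.lie_lie, ← hR (gb x y), hact, hR, hR, hR, hR]
  · exact LinearMap.ext fun x => hn.eq_of_ad_eq hc.1 fun z => by rw [← hS.2.2, hR]
end

section
/- Let n = (V, {·,·}) be a finite-dimensional Lie algebra over a field K of characteristic zero, R a Rota–Baxter operator of weight 1 on n, and let g = (V, [·,·]) be the Lie algebra with the induced bracket [x,y] = {R(x), y} − {R(y), x} + {x, y}. Then dim g⁽ⁱ⁾ ≤ dim n⁽ⁱ⁾ for all i ≥ 1, where for a Lie algebra h the derived series is defined by h⁽¹⁾ = h and h⁽ⁱ⁺¹⁾ = [h⁽ⁱ⁾, h⁽ⁱ⁾]. -/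
/-- The derived series of the Lie algebra `(V, b)`:
`derSeries 0 = V = h⁽¹⁾` and `derSeries (i+1) = [derSeries i, derSeries i]`,
so that `derSeries (i-1)` corresponds to the derived ideal `h⁽ⁱ⁾`. -/
def derSeries (K : Type*) {V : Type*} [Field K] [CharZero K] [AddCommGroup V] [Module K V]
    (b : V → V → V) : ℕ → Submodule K V
  | 0 => ⊤
  | n + 1 => Submodule.span K
      {z | ∃ x ∈ derSeries K b n, ∃ y ∈ derSeries K b n, z = b x y}

theorem derSeries_indBr_le {K V : Type*} [Field K] [CharZero K] [AddCommGroup V] [Module K V]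
    {nb : V → V → V} (hn : IsLieBr K nb) {R : V →ₗ[K] V} (hR : IsLieRB K nb R 1) (i : ℕ) :
    derSeries K (indBr nb R) i ≤ derSeries K nb i ⊓ (derSeries K nb i).comap R := by
  obtain ⟨hl, hr, ha, -⟩ := hn
  have anti : ∀ x y : V, nb x y = -nb y x := by
    intro x y
    have h := ha (x + y)
    rw [(hl (x + y)).map_add, (hr x).map_add, (hr y).map_add, ha, ha, zero_add, add_zero] at h
    exact eq_neg_of_add_eq_zero_right h
  have hRbr : ∀ x y : V, R (indBr nb R x y) = nb (R x) (R y) := by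
    intro x y
    rw [hR x y, indBr, anti x (R y), one_smul, sub_eq_add_neg]
  induction i with
  | zero => simp [derSeries]
  | succ n ih =>
    have mem : ∀ {a b : V}, a ∈ derSeries K nb n → b ∈ derSeries K nb n →
        nb a b ∈ derSeries K nb (n + 1) :=
      fun ha hb => Submodule.subset_span ⟨_, ha, _, hb, rfl⟩
    refine Submodule.span_le.2 ?_
    rintro _ ⟨x, hx, y, hy, rfl⟩
    obtain ⟨hx, hRx⟩ := ih hx
    obtain ⟨hy, hRy⟩ := ih hy
    refine ⟨add_mem (sub_mem (mem hRx hy) (mem hRy hx)) (mem hx hy), ?_⟩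
    change R _ ∈ derSeries K nb (n + 1)
    rw [hRbr]
    exact mem hRx hRy

theorem derived_series_dim_le (K : Type*) {V : Type*} [Field K] [CharZero K]
    [AddCommGroup V] [Module K V] [FiniteDimensional K V]
    (nb : V → V → V) (hn : IsLieBr K nb)
    (R : V →ₗ[K] V) (hR : IsLieRB K nb R 1) :
    ∀ i : ℕ, Module.finrank K (derSeries K (indBr nb R) i) ≤
      Module.finrank K (derSeries K nb i) := by
  intro i
  exact Submodule.finrank_mono ((derSeries_indBr_le hn hR i).trans inf_le_left)
end

section
/- Let g = (V, [·,·]) and n = (V, {·,·}) be finite-dimensional Lie algebra structures on the same vector space V over a field K of characteristic zero, with n complete, and suppose there exists a post-Lie algebra structure x·y on (g, n). Then dim g⁽ⁱ⁾ ≤ dim n⁽ⁱ⁾ for all i ≥ 1, where the derived series of a Lie algebra h is h⁽¹⁾ = h and h⁽ⁱ⁺¹⁾ = [h⁽ⁱ⁾, h⁽ⁱ⁾]. In particular, if n is solvable, then g is solvable, and if g is perfect, then n is perfect. -/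
/-- The Lie algebra `(V, b)` is solvable. -/
def IsSolvableBr (K : Type*) {V : Type*} [Field K] [CharZero K] [AddCommGroup V] [Module K V]
    (b : V → V → V) : Prop :=
  ∃ n : ℕ, derSeries K b n = ⊥

/-- The Lie algebra `(V, b)` is perfect, i.e. `[h, h] = h`. -/
def IsPerfectBr (K : Type*) {V : Type*} [Field K] [CharZero K] [AddCommGroup V] [Module K V]
    (b : V → V → V) : Prop :=
  derSeries K b 1 = ⊤

section

variable {K V : Type*} [Field K] [CharZero K] [AddCommGroup V] [Module K V]

/-- A Lie algebra homomorphism maps each term of the derived series into the corresponding one. -/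
lemma map_mem_derSeries {b c : V → V → V} (f : V →ₗ[K] V)
    (hf : ∀ x y, f (b x y) = c (f x) (f y)) (i : ℕ) :
    ∀ x ∈ derSeries K b i, f x ∈ derSeries K c i := by
  induction i with
  | zero => intro x _; exact Submodule.mem_top
  | succ n ih =>
    suffices h : derSeries K b (n + 1) ≤ (derSeries K c (n + 1)).comap f from fun x hx => h hx
    refine Submodule.span_le.2 ?_
    rintro _ ⟨x, hx, y, hy, rfl⟩
    exact Submodule.subset_span ⟨f x, ih x hx, f y, ih y hy, hf x y⟩

/-- A post-Lie product on `(g, n)` with `n` complete is given by `x·y = {R x, y}` for a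
linear map `R`. -/
lemma IsPostLie.exists_eq_bracket {gb nb mul : V → V → V} (hn : IsLieBr K nb)
    (hc : IsCompleteLie K nb) (hpl : IsPostLie K gb nb mul) :
    ∃ R : V →ₗ[K] V, ∀ x y, mul x y = nb (R x) y := by
  obtain ⟨-, hn2, -, -⟩ := hn
  obtain ⟨hz, hd⟩ := hc
  obtain ⟨hm1, hm2, -, -, hder⟩ := hpl
  have h : ∀ x, ∃ z, ∀ y, mul x y = nb z y := fun x =>
    hd (IsLinearMap.mk' (mul x) (hm1 x)) (hder x)
  choose R hR using h
  have inj : ∀ u v, (∀ y, nb u y = nb v y) → u = v := fun u v huv =>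
    sub_eq_zero.1 (hz _ fun y => by rw [(hn2 y).map_sub, huv, sub_self])
  refine ⟨⟨⟨R, fun x y => inj _ _ fun z => ?_⟩, fun a x => inj _ _ fun z => ?_⟩, hR⟩
  · rw [← hR, (hm2 z).map_add, (hn2 z).map_add, hR, hR]
  · rw [← hR, (hm2 z).map_smul, (hn2 z).map_smul, hR]
    rfl

/-- If `(g, n)` carries a post-Lie structure with `n` complete, then the derived series of `g`
is termwise contained in that of `n`. -/
lemma IsPostLie.derSeries_le {gb nb mul : V → V → V} (hn : IsLieBr K nb)
    (hc : IsCompleteLie K nb) (hpl : IsPostLie K gb nb mul) (i : ℕ) :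
    derSeries K gb i ≤ derSeries K nb i := by
  obtain ⟨R, hR⟩ := hpl.exists_eq_bracket hn hc
  obtain ⟨hn1, hn2, hn0, hj⟩ := hn
  obtain ⟨-, -, hcomm, hmod, -⟩ := hpl
  have hskew : ∀ x y, nb x y = -nb y x := fun x y => by
    have h := hn0 (x + y)
    rw [(hn1 _).map_add, (hn2 x).map_add, (hn2 y).map_add, hn0, hn0, zero_add, add_zero] at h
    exact eq_neg_of_add_eq_zero_right h
  have hhom : ∀ x y, R (gb x y) = nb (R x) (R y) := fun x y => by
    refine sub_eq_zero.1 (hc.1 _ fun z => ?_)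
    have h := hmod x y z
    simp only [hR] at h
    rw [(hn2 z).map_sub, h, hj (R x) (R y) z]
    abel
  have hhom' : ∀ x y, (R + LinearMap.id : V →ₗ[K] V) (gb x y) =
      nb ((R + LinearMap.id : V →ₗ[K] V) x) ((R + LinearMap.id : V →ₗ[K] V) y) := fun x y => by
    have h := hcomm x y
    rw [hR, hR, hskew (R y) x, sub_neg_eq_add] at h
    simp only [LinearMap.add_apply, LinearMap.id_apply]
    rw [hhom, (hn1 _).map_add, (hn2 (R y)).map_add, (hn2 y).map_add, eq_add_of_sub_eq h.symm]
    abel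
  intro x hx
  simpa using sub_mem (map_mem_derSeries _ hhom' i x hx) (map_mem_derSeries _ hhom i x hx)

end

theorem postLie_derived_dims (K : Type*) {V : Type*} [Field K] [CharZero K]
    [AddCommGroup V] [Module K V] [FiniteDimensional K V]
    (gb nb : V → V → V) (hg : IsLieBr K gb) (hn : IsLieBr K nb)
    (hc : IsCompleteLie K nb)
    (mul : V → V → V) (hpl : IsPostLie K gb nb mul) :
    (∀ i : ℕ, Module.finrank K (derSeries K gb i) ≤ Module.finrank K (derSeries K nb i)) ∧
    (IsSolvableBr K nb → IsSolvableBr K gb) ∧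
    (IsPerfectBr K gb → IsPerfectBr K nb) := by
  have hle := hpl.derSeries_le hn hc
  exact ⟨fun i => Submodule.finrank_mono (hle i),
    fun ⟨n, h⟩ => ⟨n, le_bot_iff.1 (h ▸ hle n)⟩,
    fun h => top_le_iff.1 (h.symm.le.trans (hle 1))⟩
end

section
/- Let n be a finite-dimensional simple Lie algebra over a field K of characteristic zero and let R be a bijective Rota–Baxter operator on n of nonzero weight λ. Then R = −λ·id. -/
/-- An ideal of the Lie algebra `(V, b)`. -/
def IsLieIdeal (K : Type*) {V : Type*} [Field K] [CharZero K] [AddCommGroup V] [Module K V]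
    (b : V → V → V) (I : Submodule K V) : Prop :=
  ∀ x : V, ∀ y ∈ I, b x y ∈ I

/-- The Lie algebra `(V, b)` is simple: it is non-abelian and has no ideals
other than `⊥` and `⊤`. -/
def IsSimpleBr (K : Type*) {V : Type*} [Field K] [CharZero K] [AddCommGroup V] [Module K V]
    (b : V → V → V) : Prop :=
  (∃ x y : V, b x y ≠ 0) ∧
  ∀ I : Submodule K V, IsLieIdeal K b I → I = ⊥ ∨ I = ⊤

open scoped TensorProduct

/-- The homogeneous elements of the Lie subalgebra generated by those
components `F i` whose degree satisfies `P`. -/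
inductive HomogeneousGenerated {ι K L : Type*} [Mul ι] [Field K] [LieRing L] [LieAlgebra K L]
    (F : ι → Submodule K L) (P : ι → Prop) : ι → L → Prop
  | of {i : ι} {x : L} : P i → x ∈ F i → HomogeneousGenerated F P i x
  | zero (i : ι) : HomogeneousGenerated F P i 0
  | add {i : ι} {x y : L} : HomogeneousGenerated F P i x → HomogeneousGenerated F P i y →
      HomogeneousGenerated F P i (x + y)
  | smul {i : ι} {x : L} (c : K) : HomogeneousGenerated F P i x →
      HomogeneousGenerated F P i (c • x)
  | lie {i j : ι} {x y : L} : HomogeneousGenerated F P i x → HomogeneousGenerated F P j y →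
      HomogeneousGenerated F P (i * j) ⁅x, y⁆

namespace HomogeneousGenerated

variable {ι K L : Type*} [CommMonoid ι] [Field K] [LieRing L] [LieAlgebra K L]
  {F : ι → Submodule K L}

theorem mem {P : ι → Prop} (hF : ∀ i j, ∀ x ∈ F i, ∀ y ∈ F j, ⁅x, y⁆ ∈ F (i * j))
    {i : ι} {x : L} (hx : HomogeneousGenerated F P i x) : x ∈ F i := by
  induction hx with
  | of _ h => exact h
  | zero i => exact zero_mem _
  | add _ _ h₁ h₂ => exact add_mem h₁ h₂
  | smul c _ h => exact Submodule.smul_mem _ c h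
  | lie _ _ h₁ h₂ => exact hF _ _ _ h₁ _ h₂

theorem eq_zero {P : ι → Prop} (hP : ∀ i, ¬ P i)
    {i : ι} {x : L} (hx : HomogeneousGenerated F P i x) : x = 0 := by
  induction hx with
  | of h _ => exact absurd h (hP _)
  | zero i => rfl
  | add _ _ h₁ h₂ => rw [h₁, h₂, add_zero]
  | smul c _ h => rw [h, smul_zero]
  | lie _ _ h₁ h₂ => rw [h₁, zero_lie]

theorem mono {P Q : ι → Prop} {i : ι} {x : L} (hx : HomogeneousGenerated F P i x)
    (h : ∀ i x, P i → x ∈ F i → HomogeneousGenerated F Q i x) :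
    HomogeneousGenerated F Q i x := by
  induction hx with
  | of h₁ h₂ => exact h _ _ h₁ h₂
  | zero i => exact .zero i
  | add _ _ h₁ h₂ => exact .add h₁ h₂
  | smul c _ h => exact .smul c h
  | lie _ _ h₁ h₂ => exact .lie h₁ h₂

theorem lie_succ {n : ℕ} [NeZero n] (d : ι → ZMod n)
    (hF : ∀ i j, ∀ x ∈ F i, ∀ y ∈ F j, ⁅x, y⁆ ∈ F (i * j))
    (hd : ∀ i j, F i ≠ ⊥ → F j ≠ ⊥ → d (i * j) = d i + d j)
    (hd0 : ∀ i, d i = 0 → F i = ⊥) {k : ℕ} {j : ι} {w : L}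
    (hw : HomogeneousGenerated F (fun i => k ≤ (d i).val) j w) :
    ∀ (i : ι), ∀ v ∈ F i, (d (i * j)).val = k →
      HomogeneousGenerated F (fun i => k + 1 ≤ (d i).val) (i * j) ⁅v, w⁆ := by
  induction hw with
  | zero j => intro i v _ _; rw [lie_zero]; exact .zero _
  | add _ _ h₁ h₂ => intro i v hv hk; rw [lie_add]; exact .add (h₁ i v hv hk) (h₂ i v hv hk)
  | smul c _ h => intro i v hv hk; rw [lie_smul]; exact .smul c (h i v hv hk)
  | @lie a b x y hx hy h₁ h₂ =>
    intro i v hv hk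
    have e₁ : i * a * b = i * (a * b) := mul_assoc _ _ _
    have e₂ : i * b * a = i * (a * b) := by rw [mul_assoc, mul_comm b a]
    have H₁ := h₂ (i * a) ⁅v, x⁆ (hF _ _ _ hv _ (hx.mem hF)) (by rw [e₁, hk])
    have H₂ := h₁ (i * b) ⁅v, y⁆ (hF _ _ _ hv _ (hy.mem hF)) (by rw [e₂, hk])
    rw [e₁] at H₁
    rw [e₂] at H₂
    have e : ⁅v, ⁅x, y⁆⁆ = ⁅⁅v, x⁆, y⁆ + (-1 : K) • ⁅⁅v, y⁆, x⁆ := by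
      rw [leibniz_lie, neg_one_smul, lie_skew]
    rw [e]
    exact .add H₁ (.smul _ H₂)
  | @of j w hj hw =>
    intro i v hv hk
    by_cases hv0 : v = 0
    · rw [hv0, zero_lie]; exact .zero _
    by_cases hw0 : w = 0
    · rw [hw0, lie_zero]; exact .zero _
    have hi : F i ≠ ⊥ := fun h => hv0 (by simpa [h] using hv)
    have hj' : F j ≠ ⊥ := fun h => hw0 (by simpa [h] using hw)
    have hi0 : (d i).val ≠ 0 := fun h => hi (hd0 i ((ZMod.val_eq_zero _).1 h))
    rw [hd i j hi hj', ZMod.val_add] at hk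
    have hilt := (d i).val_lt
    have hjlt := (d j).val_lt
    have key : n ≤ (d i).val + (d j).val := by
      by_contra hlt
      rw [Nat.mod_eq_of_lt (by omega)] at hk
      omega
    rw [Nat.mod_eq_sub_mod key, Nat.mod_eq_of_lt (by omega)] at hk
    exact .lie (.of (by omega) hv) (.of (by omega) hw)

end HomogeneousGenerated

/-- A perfect graded Lie algebra with cyclic grading and trivial zero component vanishes
(Kreknin). -/
theorem eq_bot_of_graded_perfect {ι K L : Type*} [CommMonoid ι] [Field K] [LieRing L]
    [LieAlgebra K L] {F : ι → Submodule K L} {n : ℕ} [NeZero n] (d : ι → ZMod n)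
    (hF : ∀ i j, ∀ x ∈ F i, ∀ y ∈ F j, ⁅x, y⁆ ∈ F (i * j))
    (hd : ∀ i j, F i ≠ ⊥ → F j ≠ ⊥ → d (i * j) = d i + d j)
    (hd0 : ∀ i, d i = 0 → F i = ⊥)
    (hp : ∀ i, F i ≤
      Submodule.span K {z | ∃ a b x y, a * b = i ∧ x ∈ F a ∧ y ∈ F b ∧ ⁅x, y⁆ = z}) (i : ι) :
    F i = ⊥ := by
  have main : ∀ k : ℕ, ∀ i, ∀ x ∈ F i,
      HomogeneousGenerated F (fun i => k ≤ (d i).val) i x := by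
    intro k
    induction k with
    | zero => exact fun i x hx => .of (Nat.zero_le _) hx
    | succ k ih =>
      intro i x hx
      refine (ih i x hx).mono fun i x hi hx => ?_
      rcases hi.lt_or_eq with hlt | heq
      · exact .of hlt hx
      · replace hx := hp i hx
        induction hx using Submodule.span_induction with
        | mem z hz =>
          obtain ⟨a, b, x, y, rfl, hx, hy, rfl⟩ := hz
          exact (ih b y hy).lie_succ d hF hd hd0 a x hx heq.symm
        | zero => exact .zero _
        | add _ _ _ _ h₁ h₂ => exact .add h₁ h₂
        | smul c _ _ h => exact .smul c h
  exact (Submodule.eq_bot_iff _).2 fun x hx =>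
    (main n i x hx).eq_zero fun j => (d j).val_lt.not_ge

instance Int.instIsJacobsonRing : IsJacobsonRing ℤ := by
  refine isJacobsonRing_iff_prime_eq.2 fun P hP => ?_
  by_cases h : P = ⊥
  · subst h
    refine (Submodule.eq_bot_iff _).2 fun x hx => ?_
    have := Ideal.mem_jacobson_bot.1 hx x
    rcases Int.isUnit_iff.1 this with h | h
    · simpa using h
    · nlinarith [mul_self_nonneg x]
  · have := hP.isMaximal h
    exact Ideal.jacobson_eq_self_of_isMaximal

/-- Finitely many elements of a field, none equal to `0` or `1`, admit a multiplicative
character to a finite cyclic group which is trivial on none of them. -/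
theorem exists_zmod_character {K : Type*} [Field K] (S : Finset K)
    (h0 : (0 : K) ∉ S) (h1 : (1 : K) ∉ S) :
    ∃ (n : ℕ) (_ : NeZero n) (d : K → ZMod n), (∀ a ∈ S, d a ≠ 0) ∧
      ∀ a ∈ S, ∀ b ∈ S, d (a * b) = d a + d b := by
  classical
  let T : Finset K := S ∪ S.image (fun a => a⁻¹) ∪ S.image (fun a => (a - 1)⁻¹)
  let B : Subalgebra ℤ K := Algebra.adjoin ℤ (T : Set K)
  have : Algebra.FiniteType ℤ B := (Subalgebra.fg_iff_finiteType B).1 ⟨T, rfl⟩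
  obtain ⟨m, hm⟩ := Ideal.exists_maximal B
  let E := B ⧸ m
  let _ : Field E := Ideal.Quotient.field m
  have : Algebra.FiniteType ℤ E :=
    .of_surjective (Ideal.Quotient.mkₐ ℤ m) (Ideal.Quotient.mkₐ_surjective ℤ m)
  have : Module.Finite ℤ E := finite_of_finite_type_of_isJacobsonRing ℤ E
  have : Finite E := by
    obtain ⟨p, hp⟩ := CharP.exists E
    have hp0 : p ≠ 0 := by
      rintro rfl
      have : CharZero E := CharP.charP_to_charZero E
      exact Int.not_isField (isField_of_isIntegral_of_isField
        (R := ℤ) (S := E) (algebraMap ℤ E).injective_int (Field.toIsField E))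
    refine Module.finite_of_fg_torsion E fun x => ?_
    refine ⟨⟨(p : ℤ), mem_nonZeroDivisors_of_ne_zero (by exact_mod_cast hp0)⟩, ?_⟩
    change (p : ℤ) • x = 0
    simp
  let n := Nat.card Eˣ
  have hn : NeZero n := ⟨Nat.card_pos.ne'⟩
  let e : Multiplicative (ZMod n) ≃* Eˣ := zmodCyclicMulEquiv (inferInstance : IsCyclic Eˣ)
  let π : B →+* E := Ideal.Quotient.mk m
  let d : K → ZMod n := fun a =>
    if h : ∃ u : Eˣ, ∃ ha : a ∈ B, π ⟨a, ha⟩ = u then (e.symm h.choose).toAdd else 0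
  have hd : ∀ (a : K) (ha : a ∈ B) (u : Eˣ), π ⟨a, ha⟩ = u → d a = (e.symm u).toAdd := by
    intro a ha u hu
    have h : ∃ u : Eˣ, ∃ ha : a ∈ B, π ⟨a, ha⟩ = u := ⟨u, ha, hu⟩
    have : h.choose = u := by
      obtain ⟨ha', h'⟩ := h.choose_spec
      exact Units.ext (h'.symm.trans hu)
    simp only [d, dif_pos h, this]
  have hT : ∀ a ∈ T, a ∈ B := fun a ha => Algebra.subset_adjoin ha
  have hSB : ∀ a ∈ S, a ∈ B := fun a ha => hT a (by simp [T, ha])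
  have hu : ∀ a (ha : a ∈ S), ∃ u : Eˣ, π ⟨a, hSB a ha⟩ = u := by
    intro a ha
    have ha0 : a ≠ 0 := fun h => h0 (h ▸ ha)
    have hi : a⁻¹ ∈ B := hT _ (by
      simp only [T, Finset.mem_union, Finset.mem_image]; exact .inl (.inr ⟨a, ha, rfl⟩))
    have hunit : IsUnit (⟨a, hSB a ha⟩ : B) :=
      IsUnit.of_mul_eq_one ⟨a⁻¹, hi⟩ (Subtype.ext (mul_inv_cancel₀ ha0))
    obtain ⟨u, hu⟩ := hunit.map π
    exact ⟨u, hu.symm⟩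
  refine ⟨n, hn, d, fun a ha hda => ?_, fun a ha b hb => ?_⟩
  · obtain ⟨u, hu⟩ := hu a ha
    rw [hd a _ u hu, toAdd_eq_zero, map_eq_one_iff e.symm e.symm.injective] at hda
    have ha1 : a - 1 ≠ 0 := fun h => h1 (sub_eq_zero.1 h ▸ ha)
    have hi : (a - 1)⁻¹ ∈ B := hT _ (by
      simp only [T, Finset.mem_union, Finset.mem_image]; exact .inr ⟨a, ha, rfl⟩)
    have hunit : IsUnit ((⟨a, hSB a ha⟩ : B) - 1) :=
      IsUnit.of_mul_eq_one ⟨(a - 1)⁻¹, hi⟩ (Subtype.ext (mul_inv_cancel₀ ha1))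
    have := (hunit.map π).ne_zero
    rw [map_sub, map_one, hu, hda] at this
    simp at this
  · obtain ⟨u, hu'⟩ := hu a ha
    obtain ⟨v, hv'⟩ := hu b hb
    rw [hd a _ u hu', hd b _ v hv', hd (a * b) (mul_mem (hSB a ha) (hSB b hb)) (u * v),
      map_mul, toAdd_mul]
    rw [Units.val_mul, ← hu', ← hv', ← map_mul]
    rfl

theorem iSupIndep.le_of_iSup_eq_top {ι K V : Type*} [Ring K] [AddCommGroup V] [Module K V]
    {F G : ι → Submodule K V} (hF : iSupIndep F) (hG : ∀ i, G i ≤ F i) (htop : ⨆ i, G i = ⊤)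
    (i : ι) : F i ≤ G i := by
  have h : G i ⊔ ⨆ j, ⨆ (_ : j ≠ i), G j = ⊤ := by
    rw [eq_top_iff, ← htop]
    refine iSup_le fun j => ?_
    by_cases hj : j = i
    · subst hj; exact le_sup_left
    · exact le_sup_of_le_right (le_iSup₂_of_le j hj le_rfl)
  have hdis : F i ⊓ ⨆ j, ⨆ (_ : j ≠ i), G j = ⊥ :=
    ((hF i).mono_right (iSup₂_mono fun j _ => hG j)).eq_bot
  calc F i = (G i ⊔ ⨆ j, ⨆ (_ : j ≠ i), G j) ⊓ F i := by rw [h, top_inf_eq]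
    _ = G i ⊔ (⨆ j, ⨆ (_ : j ≠ i), G j) ⊓ F i := sup_inf_assoc_of_le _ (hG i)
    _ ≤ G i := by rw [inf_comm, hdis, sup_bot_eq]

theorem LieHom.lie_mem_maxGenEigenspace_mul {K L : Type*} [Field K] [LieRing L] [LieAlgebra K L]
    (f : L →ₗ⁅K⁆ L) (a b : K) {x y : L}
    (hx : x ∈ Module.End.maxGenEigenspace (f : L →ₗ[K] L) a)
    (hy : y ∈ Module.End.maxGenEigenspace (f : L →ₗ[K] L) b) :
    ⁅x, y⁆ ∈ Module.End.maxGenEigenspace (f : L →ₗ[K] L) (a * b) := by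
  let g : Module.End K L := (f : L →ₗ[K] L)
  have key : ∀ (m p q : ℕ), p + q = m → ∀ x y : L, ((g - a • 1) ^ p) x = 0 →
      ((g - b • 1) ^ q) y = 0 → ((g - (a * b) • 1) ^ m) ⁅x, y⁆ = 0 := by
    intro m
    induction m with
    | zero =>
      intro p q hpq x y hx _
      obtain rfl : p = 0 := by omega
      have : x = 0 := by simpa using hx
      simp [this]
    | succ m ih =>
      intro p q hpq x y hx hy
      rcases p with _ | p
      · have : x = 0 := by simpa using hx
        simp [this]
      rcases q with _ | q
      · have : y = 0 := by simpa using hy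
        simp [this]
      have e : (g - (a * b) • 1) ⁅x, y⁆ = ⁅(g - a • 1) x, g y⁆ + a • ⁅x, (g - b • 1) y⁆ := by
        simp only [g, LinearMap.sub_apply, LinearMap.smul_apply, Module.End.one_apply,
          LieHom.coe_toLinearMap, LieHom.map_lie, sub_lie, lie_sub, smul_lie, lie_smul, smul_sub,
          smul_smul]
        abel
      have hgy : ((g - b • 1) ^ (q + 1)) (g y) = 0 := by
        have hc : Commute ((g - b • 1) ^ (q + 1)) g :=
          (((Commute.refl g).sub_left ((Commute.one_left g).smul_left b))).pow_left _
        have := congrArg (fun t : Module.End K L => t y) hc.eq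
        simp only [Module.End.mul_apply] at this
        rw [this, hy, map_zero]
      rw [pow_succ, Module.End.mul_apply, e, map_add, map_smul,
        ih p (q + 1) (by omega) _ _ (by rwa [pow_succ] at hx) hgy,
        ih (p + 1) q (by omega) _ _ hx (by rwa [pow_succ] at hy)]
      simp
  rw [Module.End.mem_maxGenEigenspace] at hx hy ⊢
  obtain ⟨p, hp⟩ := hx
  obtain ⟨q, hq⟩ := hy
  exact ⟨p + q, key _ p q rfl x y hp hq⟩

theorem subsingleton_of_fixedPointFree_of_isAlgClosed {K L : Type*} [Field K] [IsAlgClosed K]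
    [LieRing L] [LieAlgebra K L] [FiniteDimensional K L] (f : L →ₗ⁅K⁆ L)
    (hinj : Function.Injective f) (hfix : ∀ x, f x = x → x = 0)
    (hperf : Submodule.span K {z : L | ∃ x y : L, ⁅x, y⁆ = z} = ⊤) : Subsingleton L := by
  let g : Module.End K L := (f : L →ₗ[K] L)
  let F : K → Submodule K L := g.maxGenEigenspace
  have hmul : ∀ i j, ∀ x ∈ F i, ∀ y ∈ F j, ⁅x, y⁆ ∈ F (i * j) :=
    fun i j x hx y hy => f.lie_mem_maxGenEigenspace_mul i j hx hy
  have hind : iSupIndep F := g.independent_maxGenEigenspace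
  have htop : ⨆ i, F i = ⊤ := Module.End.iSup_maxGenEigenspace_eq_top g
  have hfin : {i | F i ≠ ⊥}.Finite := Submodule.finite_ne_bot_of_iSupIndep hind
  have hF0 : ∀ a, (∀ x, g x = a • x → x = 0) → F a = ⊥ := by
    intro a ha
    have hi : Function.Injective (g - a • 1 : Module.End K L) := by
      rw [injective_iff_map_eq_zero]
      intro x hx
      exact ha x (by simpa [sub_eq_zero] using hx)
    refine (Submodule.eq_bot_iff _).2 fun x hx => ?_
    obtain ⟨k, hk⟩ := (Module.End.mem_maxGenEigenspace g a x).1 hx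
    have : Function.Injective ((g - a • 1 : Module.End K L) ^ k) := by
      rw [Module.End.coe_pow]; exact hi.iterate k
    exact this (by rw [hk, map_zero])
  obtain ⟨n, hn, d, hd0, hd⟩ := exists_zmod_character hfin.toFinset
    (by
      simp only [Set.Finite.mem_toFinset, Set.mem_ofPred_eq, not_not]
      exact hF0 0 fun x hx => hinj (by simpa [g] using hx))
    (by
      simp only [Set.Finite.mem_toFinset, Set.mem_ofPred_eq, not_not]
      exact hF0 1 fun x hx => hfix x (by simpa [g] using hx))
  simp only [Set.Finite.mem_toFinset, Set.mem_ofPred_eq] at hd0 hd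
  let G : K → Submodule K L := fun i =>
    Submodule.span K {z | ∃ a b x y, a * b = i ∧ x ∈ F a ∧ y ∈ F b ∧ ⁅x, y⁆ = z}
  have hGF : ∀ i, G i ≤ F i := by
    refine fun i => Submodule.span_le.2 ?_
    rintro _ ⟨a, b, x, y, rfl, hx, hy, rfl⟩
    exact hmul a b x hx y hy
  have hG : ⨆ i, G i = ⊤ := by
    rw [eq_top_iff, ← hperf, Submodule.span_le]
    rintro _ ⟨x, y, rfl⟩
    have hx : x ∈ ⨆ i, F i := htop ▸ Submodule.mem_top
    have hy : y ∈ ⨆ i, F i := htop ▸ Submodule.mem_top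
    change ⁅x, y⁆ ∈ ⨆ i, G i
    induction hx using Submodule.iSup_induction' with
    | zero => rw [zero_lie]; exact zero_mem _
    | add _ _ _ _ h₁ h₂ => rw [add_lie]; exact add_mem h₁ h₂
    | mem a x hx =>
      induction hy using Submodule.iSup_induction' with
      | zero => rw [lie_zero]; exact zero_mem _
      | add _ _ _ _ h₁ h₂ => rw [lie_add]; exact add_mem h₁ h₂
      | mem b y hy =>
        exact Submodule.mem_iSup_of_mem (a * b)
          (Submodule.subset_span ⟨a, b, x, y, rfl, hx, hy, rfl⟩)
  have hbot := eq_bot_of_graded_perfect d hmul (fun i j hi hj => hd i hi j hj)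
    (fun i hi => by_contra fun h => hd0 i h hi) (hind.le_of_iSup_eq_top hGF hG)
  rw [iSup_congr hbot, iSup_bot] at htop
  exact (Submodule.subsingleton_iff K).1 (subsingleton_of_bot_eq_top htop)

/-- A perfect finite-dimensional Lie algebra with an automorphism fixing only zero vanishes. -/
theorem subsingleton_of_fixedPointFree {K L : Type*} [Field K]
    [LieRing L] [LieAlgebra K L] [FiniteDimensional K L] (f : L →ₗ⁅K⁆ L)
    (hinj : Function.Injective f) (hfix : ∀ x, f x = x → x = 0)
    (hperf : Submodule.span K {z : L | ∃ x y : L, ⁅x, y⁆ = z} = ⊤) : Subsingleton L := by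
  let A := AlgebraicClosure K
  let g : L →ₗ[K] L := f
  let h : A ⊗[K] L →ₗ[A] A ⊗[K] L := g.baseChange A
  have hbc : ∀ u : L →ₗ[K] L, Function.Injective u →
      Function.Injective (LinearMap.baseChange A u) :=
    fun u hu => Module.Flat.lTensor_preserves_injective_linearMap (M := A) u hu
  have hlie : ∀ x y : A ⊗[K] L, h ⁅x, y⁆ = ⁅h x, h y⁆ := by
    intro x y
    induction x using TensorProduct.induction_on with
    | zero => simp
    | add _ _ h₁ h₂ => simp only [add_lie, map_add, h₁, h₂]
    | tmul a x =>
      induction y using TensorProduct.induction_on with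
      | zero => simp
      | add _ _ h₁ h₂ => simp only [lie_add, map_add, h₁, h₂]
      | tmul b y => simp [h, g]
  let φ : A ⊗[K] L →ₗ⁅A⁆ A ⊗[K] L := { h with map_lie' := fun {x y} => hlie x y }
  have hsub : Subsingleton (A ⊗[K] L) := by
    refine subsingleton_of_fixedPointFree_of_isAlgClosed φ (hbc g hinj) (fun x hx => ?_) ?_
    · have hi : Function.Injective (g - LinearMap.id : L →ₗ[K] L) := by
        rw [injective_iff_map_eq_zero]
        exact fun x hx => hfix x (by simpa [g, sub_eq_zero] using hx)
      refine hbc _ hi ?_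
      rw [LinearMap.baseChange_sub, LinearMap.baseChange_id, map_zero, LinearMap.sub_apply,
        LinearMap.id_apply, sub_eq_zero]
      exact hx
    · refine (Submodule.eq_top_iff').2 ?_
      intro t
      induction t using TensorProduct.induction_on with
      | zero => exact zero_mem _
      | add _ _ h₁ h₂ => exact add_mem h₁ h₂
      | tmul a x =>
        have hx : x ∈ Submodule.span K {z : L | ∃ x y : L, ⁅x, y⁆ = z} := hperf ▸ trivial
        induction hx using Submodule.span_induction with
        | mem z hz =>
          obtain ⟨x, y, rfl⟩ := hz
          exact Submodule.subset_span ⟨a ⊗ₜ x, 1 ⊗ₜ y, by simp⟩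
        | zero => rw [TensorProduct.tmul_zero]; exact zero_mem _
        | add _ _ _ _ h₁ h₂ => rw [TensorProduct.tmul_add]; exact add_mem h₁ h₂
        | smul c x _ h =>
          rw [TensorProduct.tmul_smul, ← algebraMap_smul A c]
          exact Submodule.smul_mem _ _ h
  refine ⟨fun x y => ?_⟩
  have hone : Function.Injective fun x : L => (1 : A) ⊗ₜ[K] x :=
    Module.FaithfullyFlat.tensorProduct_mk_injective L
  exact hone (Subsingleton.elim _ _)

/-- The Lie ring structure given by a Lie bracket. -/
abbrev IsLieBr.lieRing {K V : Type*} [Field K] [CharZero K] [AddCommGroup V] [Module K V]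
    {b : V → V → V} (hb : IsLieBr K b) : LieRing V where
  bracket := b
  add_lie x y z := (hb.2.1 z).map_add x y
  lie_add x y z := (hb.1 x).map_add y z
  lie_self x := hb.2.2.1 x
  leibniz_lie x y z := hb.2.2.2 x y z

theorem invertible_rb_on_simple (K : Type*) {V : Type*} [Field K] [CharZero K]
    [AddCommGroup V] [Module K V] [FiniteDimensional K V]
    (nb : V → V → V) (hn : IsLieBr K nb) (hs : IsSimpleBr K nb)
    (lam : K) (hlam : lam ≠ 0)
    (R : V →ₗ[K] V) (hR : IsLieRB K nb R lam) (hbij : Function.Bijective R) :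
    R = -(lam • LinearMap.id) := by
  let _ : LieRing V := hn.lieRing
  let _ : LieAlgebra K V := { ‹Module K V› with lie_smul := fun c x y => (hn.1 x).map_smul c y }
  obtain ⟨⟨x₀, y₀, hxy₀⟩, hideal⟩ := hs
  let e : V ≃ₗ[K] V := LinearEquiv.ofBijective R hbij
  let D : V →ₗ[K] V := e.symm
  have hRD : ∀ x, R (D x) = x := e.apply_symm_apply
  have hDR : ∀ x, D (R x) = x := e.symm_apply_apply
  have hD : ∀ x y : V, D ⁅x, y⁆ = ⁅x, D y⁆ + ⁅D x, y⁆ + lam • ⁅D x, D y⁆ := by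
    intro x y
    have h : ⁅R (D x), R (D y)⁆ = R (⁅R (D x), D y⁆ + ⁅D x, R (D y)⁆ + lam • ⁅D x, D y⁆) :=
      hR (D x) (D y)
    simp only [hRD] at h
    rw [h, hDR]
  let f : V →ₗ⁅K⁆ V :=
    { LinearMap.id + lam • D with
      map_lie' := by
        intro x y
        simp only [AddHom.toFun_eq_coe, LinearMap.coe_toAddHom, LinearMap.add_apply,
          LinearMap.id_apply, LinearMap.smul_apply, hD, lie_add, add_lie, lie_smul, smul_lie,
          smul_add]
        abel }
  have hf : ∀ x, f x = x + lam • D x := fun x => rfl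
  rcases hideal (LinearMap.ker (f : V →ₗ[K] V)) (fun x y hy => by
    have hy' : f y = 0 := hy
    change f ⁅x, y⁆ = 0
    rw [LieHom.map_lie, hy', lie_zero]) with hk | hk
  · exfalso
    have hperf : Submodule.span K {z : V | ∃ x y : V, ⁅x, y⁆ = z} = ⊤ := by
      refine (hideal (Submodule.span K {z : V | ∃ x y : V, ⁅x, y⁆ = z})
        fun x y _ => Submodule.subset_span ⟨x, y, rfl⟩).resolve_left fun h => ?_
      have : nb x₀ y₀ ∈ Submodule.span K {z : V | ∃ x y : V, ⁅x, y⁆ = z} :=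
        Submodule.subset_span ⟨x₀, y₀, rfl⟩
      rw [h] at this
      exact hxy₀ this
    have hsub : Subsingleton V := by
      refine subsingleton_of_fixedPointFree f (LinearMap.ker_eq_bot.1 hk) (fun x hx => ?_) hperf
      rw [hf, add_eq_left, smul_eq_zero] at hx
      rw [← hRD x, hx.resolve_left hlam, map_zero]
    exact hxy₀ (Subsingleton.elim _ _)
  · ext x
    have h : f (R x) = 0 := by
      have : R x ∈ LinearMap.ker (f : V →ₗ[K] V) := hk ▸ Submodule.mem_top
      exact this
    rw [hf, hDR] at h
    simpa using eq_neg_of_add_eq_zero_left h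
end

section
/- Let g = (V, [·,·]) and n = (V, {·,·}) be finite-dimensional Lie algebra structures on the same complex vector space V, where n is simple and g is semisimple, and suppose there exists a post-Lie algebra structure x·y on the pair (g, n). Then g is simple and g is isomorphic to n as a Lie algebra. -/
/-- The derived series of the subspace `I` inside the Lie algebra `(V, b)`. -/
def derSeriesFrom (K : Type*) {V : Type*} [Field K] [CharZero K] [AddCommGroup V] [Module K V]
    (b : V → V → V) (I : Submodule K V) : ℕ → Submodule K V
  | 0 => I
  | n + 1 => Submodule.span K
      {z | ∃ x ∈ derSeriesFrom K b I n, ∃ y ∈ derSeriesFrom K b I n, z = b x y}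

/-- The Lie algebra `(V, b)` is semisimple: its only solvable ideal is zero. -/
def IsSemisimpleBr (K : Type*) {V : Type*} [Field K] [CharZero K] [AddCommGroup V] [Module K V]
    (b : V → V → V) : Prop :=
  ∀ I : Submodule K V, IsLieIdeal K b I → (∃ n : ℕ, derSeriesFrom K b I n = ⊥) → I = ⊥

/-- An isomorphism of the Lie algebras `(V, b)` and `(W, b')`. -/
def LieBrIso (K : Type*) {V W : Type*} [Field K] [CharZero K] [AddCommGroup V] [Module K V]
    [AddCommGroup W] [Module K W] (b : V → V → V) (b' : W → W → W) : Prop :=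
  ∃ e : V ≃ₗ[K] W, ∀ x y : V, e (b x y) = b' (e x) (e y)

namespace PostLie
open LieAlgebra Module

section Casimir

variable {K g W N ι : Type*} [Field K] [LieRing g] [LieAlgebra K g]
  [AddCommGroup W] [Module K W] [AddCommGroup N] [Module K N] [Fintype ι] [DecidableEq ι]

theorem sum_dualBasis_left (B : LinearMap.BilinForm K W) (hB : B.Nondegenerate)
    (b : Basis ι K W) (u : W) : ∑ i, B (B.dualBasis hB b i) u • b i = u := by
  conv_rhs => rw [← b.sum_repr u]
  refine Finset.sum_congr rfl fun i _ => ?_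
  have h : B (B.dualBasis hB b i) = b.coord i := b.ext fun j => by
    simp [LinearMap.BilinForm.apply_dualBasis_left, Finsupp.single_apply]
  rw [h, Basis.coord_apply]

theorem sum_dualBasis_right (B : LinearMap.BilinForm K W) (hB : B.Nondegenerate)
    (b : Basis ι K W) (u : W) : ∑ i, B u (b i) • B.dualBasis hB b i = u := by
  conv_rhs => rw [← (B.dualBasis hB b).sum_repr u]
  simp

/-- Dual bases of an invariant form make up an invariant tensor. -/
theorem sum_dualBasis_invariant [LieRingModule g W] [LieModule K g W]
    (B : LinearMap.BilinForm K W) (hB : B.Nondegenerate)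
    (hinv : ∀ (x : g) u v, B ⁅x, u⁆ v = - B u ⁅x, v⁆) (b : Basis ι K W) (x : g)
    (F : W →ₗ[K] W →ₗ[K] N) :
    ∑ i, (F ⁅x, b i⁆ (B.dualBasis hB b i) + F (b i) ⁅x, B.dualBasis hB b i⁆) = 0 := by
  rw [Finset.sum_add_distrib]
  have h1 : ∀ i, F ⁅x, b i⁆ (B.dualBasis hB b i) =
      ∑ j, B (B.dualBasis hB b j) ⁅x, b i⁆ • F (b j) (B.dualBasis hB b i) := by
    intro i
    conv_lhs => rw [← sum_dualBasis_left B hB b ⁅x, b i⁆]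
    simp
  have h2 : ∀ i, F (b i) ⁅x, B.dualBasis hB b i⁆ =
      ∑ j, - (B (B.dualBasis hB b i) ⁅x, b j⁆) • F (b i) (B.dualBasis hB b j) := by
    intro i
    conv_lhs => rw [← sum_dualBasis_right B hB b ⁅x, B.dualBasis hB b i⁆]
    simp [hinv]
  simp_rw [h1, h2]
  rw [Finset.sum_comm, ← Finset.sum_add_distrib]
  simp

end Casimir

section Perfect

variable (K g : Type*) [Field K] [LieRing g] [LieAlgebra K g]
    [FiniteDimensional K g] [LieAlgebra.IsKilling K g]

theorem top_lie_top_of_isKilling :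
    ⁅(⊤ : LieIdeal K g), (⊤ : LieIdeal K g)⁆ = ⊤ := by
  set J := ⁅(⊤ : LieIdeal K g), (⊤ : LieIdeal K g)⁆ with hJ
  have h : LieIdeal.killingCompl K g J = ⊥ := by
    rw [eq_bot_iff]
    intro x hx
    rw [LieIdeal.mem_killingCompl] at hx
    have hc : ∀ y : g, ⁅x, y⁆ = 0 := by
      intro y
      have hk := LieAlgebra.IsKilling.killingForm_nondegenerate K g
      apply hk.1
      intro z
      have : ⁅y, z⁆ ∈ J := LieSubmodule.lie_mem_lie (LieSubmodule.mem_top _) (LieSubmodule.mem_top _)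
      have h2 := hx _ this
      rw [LieModule.traceForm_comm] at h2
      rw [killingForm, LieModule.traceForm_apply_lie_apply]; exact h2
    have : x ∈ LieAlgebra.center K g := by
      rw [LieModule.mem_maxTrivSubmodule]
      intro y; rw [← lie_skew, hc, neg_zero]
    rw [LieAlgebra.center_eq_bot] at this
    exact this
  have h3 := (LieIdeal.isCompl_killingCompl (K := K) J).sup_eq_top
  rwa [h, sup_bot_eq] at h3

theorem span_lie_of_isKilling : Submodule.span K {z : g | ∃ x y : g, ⁅x, y⁆ = z} = ⊤ := by
  have h := congrArg LieSubmodule.toSubmodule (top_lie_top_of_isKilling K g)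
  rw [LieSubmodule.lieIdeal_oper_eq_linear_span] at h
  rw [← LieSubmodule.top_toSubmodule (R := K) (L := g) (M := g), ← h]
  congr 1
  ext z
  simp

variable {K g} in
/-- Linear maps that agree on brackets agree. -/
theorem linearMap_ext_lie {N : Type*} [AddCommGroup N] [Module K N] {f f' : g →ₗ[K] N}
    (h : ∀ x y : g, f ⁅x, y⁆ = f' ⁅x, y⁆) : f = f' := by
  refine LinearMap.ext_on (span_lie_of_isKilling K g) ?_
  rintro _ ⟨x, y, rfl⟩
  exact h x y

end Perfect

universe v

theorem lie_mem_top_lie {K L M : Type*} [CommRing K] [LieRing L] [LieAlgebra K L] [AddCommGroup M] [Module K M]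
    [LieRingModule L M] [LieModule K L M] (x : L) (m : M) :
    ⁅x, m⁆ ∈ ⁅(⊤ : LieIdeal K L), (⊤ : LieSubmodule K L M)⁆ :=
  LieSubmodule.lie_mem_lie (LieSubmodule.mem_top _) (LieSubmodule.mem_top _)

section Weyl

variable (K g : Type*) [Field K] [CharZero K] [LieRing g] [LieAlgebra K g]
  [FiniteDimensional K g] [LieAlgebra.IsKilling K g]

/-- The kernel of the trace form, as an ideal. -/
noncomputable def traceKer (M : Type*) [AddCommGroup M] [Module K M] [LieRingModule g M] [LieModule K g M] :
    LieIdeal K g where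
  __ := LinearMap.ker (LieModule.traceForm K g M)
  lie_mem {x y} hy := by
    simp only [AddSubsemigroup.mem_carrier, AddSubmonoid.mem_toSubsemigroup,
      Submodule.mem_toAddSubmonoid, LinearMap.mem_ker] at hy ⊢
    ext z
    rw [← lie_skew, map_neg, LinearMap.neg_apply, LieModule.traceForm_apply_lie_apply, hy]
    simp

variable {K g}

theorem mem_traceKer {M : Type*} [AddCommGroup M] [Module K M] [LieRingModule g M]
    [LieModule K g M] {x : g} :
    x ∈ traceKer K g M ↔ LieModule.traceForm K g M x = 0 := Iff.rfl

variable {M : Type*} [AddCommGroup M] [Module K M] [LieRingModule g M] [LieModule K g M]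

/-- The Casimir operator of the trace form on a module with nonzero trace form. -/
theorem exists_casimir [FiniteDimensional K M] (hM : LieModule.traceForm K g M ≠ 0) :
    ∃ C : M →ₗ⁅K, g⁆ M, (∀ m ∈ LieModule.maxTrivSubmodule K g M, C m = 0) ∧
      (∀ m, C m ∈ ⁅(⊤ : LieIdeal K g), (⊤ : LieSubmodule K g M)⁆) ∧
      ¬ IsNilpotent (C : M →ₗ[K] M) := by
  set I := LieIdeal.killingCompl K g (traceKer K g M) with hI
  have hc : IsCompl (traceKer K g M) I := LieIdeal.isCompl_killingCompl _
  have hI0 : I ≠ ⊥ := by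
    intro h
    have := hc.sup_eq_top
    rw [h, sup_bot_eq] at this
    apply hM
    ext1 x
    have hx : x ∈ traceKer K g M := this ▸ LieSubmodule.mem_top x
    simp [mem_traceKer.1 hx]
  set B : LinearMap.BilinForm K I := (LieModule.traceForm K g M).restrict I with hBdef
  have hBs : ∀ x y, B x y = B y x := fun x y => LieModule.traceForm_comm K g M _ _
  have hsep : ∀ x, (∀ y, B x y = 0) → x = 0 := by
    intro x hx
    have hx2 : (x : g) ∈ traceKer K g M := by
      rw [mem_traceKer]
      ext1 y
      have hy : y ∈ traceKer K g M ⊔ I := hc.sup_eq_top ▸ LieSubmodule.mem_top y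
      obtain ⟨u, hu, v, hv, rfl⟩ := (LieSubmodule.mem_sup _ _ _).1 hy
      rw [map_add, LieModule.traceForm_comm, mem_traceKer.1 hu, LinearMap.zero_apply, zero_add]
      exact hx ⟨v, hv⟩
    have : (x : g) ∈ traceKer K g M ⊓ I := ⟨hx2, x.2⟩
    rw [hc.inf_eq_bot] at this
    exact Subtype.ext this
  have hB : B.Nondegenerate := ⟨hsep, fun x hx => hsep x fun y => by rw [hBs]; exact hx y⟩
  have hinv : ∀ (x : g) u v, B ⁅x, u⁆ v = - B u ⁅x, v⁆ := by
    intro x u v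
    change LieModule.traceForm K g M ⁅x, (u : g)⁆ v = - LieModule.traceForm K g M u ⁅x, (v : g)⁆
    rw [← lie_skew, map_neg, LinearMap.neg_apply, LieModule.traceForm_apply_lie_apply]
  let b := Module.finBasis K I
  let T : g →ₗ[K] Module.End K M := LieModule.toEnd K g M
  let C0 : M →ₗ[K] M := ∑ i, T (b i) ∘ₗ T (B.dualBasis hB b i)
  have hC0 : ∀ m, C0 m = ∑ i, ⁅(b i : g), ⁅(B.dualBasis hB b i : g), m⁆⁆ := by
    intro m; simp [C0, T]
  let C : M →ₗ⁅K, g⁆ M :=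
    { C0 with
      map_lie' := by
        intro x m
        change C0 ⁅x, m⁆ = ⁅x, C0 m⁆
        let F : I →ₗ[K] I →ₗ[K] M := LinearMap.mk₂ K (fun u v => ⁅(u : g), ⁅(v : g), m⁆⁆)
          (by intros; simp) (by intros; simp) (by intros; simp) (by intros; simp)
        have h := sum_dualBasis_invariant B hB hinv b x F
        rw [hC0, hC0, lie_sum, ← sub_eq_zero, ← Finset.sum_sub_distrib, ← neg_eq_zero,
          ← Finset.sum_neg_distrib, ← h]
        refine Finset.sum_congr rfl fun i _ => ?_
        simp only [F, LinearMap.mk₂_apply, LieSubmodule.coe_bracket, neg_sub]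
        rw [leibniz_lie x, leibniz_lie x (B.dualBasis hB b i : g) m]
        simp only [lie_add]
        abel }
  refine ⟨C, fun m hm => ?_, fun m => ?_, fun hn => ?_⟩
  · change C0 m = 0
    rw [hC0]
    refine Finset.sum_eq_zero fun i _ => ?_
    rw [(LieModule.mem_maxTrivSubmodule _ _ _ _).1 hm, lie_zero]
  · change C0 m ∈ _
    rw [hC0]
    exact sum_mem fun i _ => lie_mem_top_lie _ _
  · have h0 : LinearMap.trace K M C0 = 0 :=
      (LinearMap.isNilpotent_trace_of_isNilpotent (f := C0) hn).eq_zero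
    have h1 : LinearMap.trace K M C0 = (finrank K I : K) := by
      simp only [C0, map_sum]
      have : ∀ i, LinearMap.trace K M (T (b i) ∘ₗ T (B.dualBasis hB b i)) = 1 := by
        intro i
        have := LinearMap.BilinForm.apply_dualBasis_left hB b i i
        rw [hBs] at this
        exact this.trans (if_pos rfl)
      simp [this]
    rw [h0] at h1
    have h2 : finrank K I = 0 := by exact_mod_cast h1.symm
    apply hI0
    exact LieSubmodule.toSubmodule_injective (Submodule.finrank_eq_zero.1 h2)

theorem top_lie_top_lie :
    ⁅(⊤ : LieIdeal K g), ⁅(⊤ : LieIdeal K g), (⊤ : LieSubmodule K g M)⁆⁆ =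
      ⁅(⊤ : LieIdeal K g), (⊤ : LieSubmodule K g M)⁆ := by
  refine le_antisymm (LieSubmodule.mono_lie_right _ le_top) ?_
  rw [LieSubmodule.lie_le_iff]
  rintro x - m -
  let N : Submodule K M :=
    ⁅(⊤ : LieIdeal K g), ⁅(⊤ : LieIdeal K g), (⊤ : LieSubmodule K g M)⁆⁆.toSubmodule
  have h : Submodule.span K {z : g | ∃ x y : g, ⁅x, y⁆ = z} ≤
      N.comap ((LieModule.toEnd K g M : g →ₗ[K] Module.End K M).flip m) := by
    rw [Submodule.span_le]
    rintro _ ⟨x, y, rfl⟩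
    change ⁅⁅x, y⁆, m⁆ ∈ N
    rw [lie_lie]
    exact sub_mem (LieSubmodule.lie_mem_lie (LieSubmodule.mem_top _) (lie_mem_top_lie _ _))
      (LieSubmodule.lie_mem_lie (LieSubmodule.mem_top _) (lie_mem_top_lie _ _))
  rw [span_lie_of_isKilling] at h
  exact h (Submodule.mem_top (x := x))

theorem lie_eq_zero_of_traceForm_eq_zero [FiniteDimensional K M]
    (hM : LieModule.traceForm K g M = 0) (x : g) (m : M) : ⁅x, m⁆ = 0 := by
  have h := LieModule.isNilpotent_derivedSeries_of_traceForm_eq_zero hM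
  have h1 : derivedSeries K g 1 = ⊤ := by
    rw [derivedSeries_def, derivedSeriesOfIdeal_succ, derivedSeriesOfIdeal_zero,
      top_lie_top_of_isKilling]
  rw [h1] at h
  have h2 : LieModule.IsNilpotent g M := LieModule.isNilpotent_of_top_iff.1 h
  obtain ⟨k, hk⟩ := (LieModule.isNilpotent_iff K g M).1 h2
  have h3 : ∀ k, ⁅(⊤ : LieIdeal K g), (⊤ : LieSubmodule K g M)⁆ ≤
      LieModule.lowerCentralSeries K g M k := by
    intro k
    induction k with
    | zero => simp
    | succ k ih =>
      rw [LieModule.lowerCentralSeries_succ, ← top_lie_top_lie]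
      exact LieSubmodule.mono_lie_right _ ih
  have h4 := h3 k (lie_mem_top_lie x m)
  rw [hk] at h4
  exact h4

theorem isCompl_maxTrivSubmodule_of_finrank_eq (n : ℕ) : ∀ (M : Type v) [AddCommGroup M] [Module K M] [LieRingModule g M]
    [LieModule K g M] [FiniteDimensional K M], finrank K M = n →
    IsCompl (LieModule.maxTrivSubmodule K g M) ⁅(⊤ : LieIdeal K g), (⊤ : LieSubmodule K g M)⁆ := by
  induction n using Nat.strong_induction_on with
  | _ n ih =>
  intro M _ _ _ _ _ hn
  by_cases hM : LieModule.traceForm K g M = 0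
  · have h := lie_eq_zero_of_traceForm_eq_zero hM
    have h1 : LieModule.maxTrivSubmodule K g M = ⊤ := by
      rw [eq_top_iff]
      intro m _ x
      exact h x m
    have h2 : ⁅(⊤ : LieIdeal K g), (⊤ : LieSubmodule K g M)⁆ = ⊥ := by
      rw [LieSubmodule.lie_eq_bot_iff]
      exact fun x _ m _ => h x m
    rw [h1, h2]
    exact isCompl_top_bot
  obtain ⟨C, hC1, hC2, hC3⟩ := exists_casimir hM
  obtain ⟨k, hk⟩ := Filter.eventually_atTop.1
    (LinearMap.eventually_isCompl_ker_pow_range_pow (C : M →ₗ[K] M))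
  have hc := hk (k + 1) (by lia)
  have hpow : ∀ (j : ℕ) (x : g) (m : M),
      ((C : M →ₗ[K] M) ^ j) ⁅x, m⁆ = ⁅x, ((C : M →ₗ[K] M) ^ j) m⁆ := by
    intro j x m
    induction j with
    | zero => simp
    | succ j ih => rw [pow_succ', Module.End.mul_apply, ih, Module.End.mul_apply]; simp
  let D : M →ₗ⁅K, g⁆ M := { (C : M →ₗ[K] M) ^ (k + 1) with map_lie' := hpow _ _ _ }
  have hD : ∀ m, D m = C (((C : M →ₗ[K] M) ^ k) m) := by
    intro m
    change ((C : M →ₗ[K] M) ^ (k + 1)) m = _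
    rw [pow_succ', Module.End.mul_apply]; rfl
  have hD' : ∀ m, D m = ((C : M →ₗ[K] M) ^ k) (C m) := by
    intro m
    change ((C : M →ₗ[K] M) ^ (k + 1)) m = _
    rw [pow_succ, Module.End.mul_apply]; rfl
  have hDc : IsCompl D.ker D.range := by
    rw [← LieSubmodule.isCompl_toSubmodule]
    exact hc
  have hrange : D.range ≤ ⁅(⊤ : LieIdeal K g), (⊤ : LieSubmodule K g M)⁆ := by
    rintro _ ⟨m, rfl⟩
    rw [hD]
    exact hC2 _
  have hlt : finrank K D.ker < n := by
    rw [← hn]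
    refine Submodule.finrank_lt (s := D.ker.toSubmodule) fun h => hC3 ⟨k + 1, ?_⟩
    ext m
    have : m ∈ D.ker.toSubmodule := h ▸ Submodule.mem_top
    exact this
  have hN := ih _ hlt D.ker rfl
  have hmap : ⁅(⊤ : LieIdeal K g), D.ker⁆ =
      LieSubmodule.map D.ker.incl ⁅(⊤ : LieIdeal K g), (⊤ : LieSubmodule K g D.ker)⁆ := by
    rw [LieSubmodule.map_bracket_eq]
    simp
  constructor
  · rw [disjoint_iff, eq_bot_iff]
    rintro m ⟨hm1, hm2⟩
    have hm : m ∈ D.ker := by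
      change D m = 0
      rw [hD', hC1 m hm1, map_zero]
    have hm2' : m ∈ ⁅(⊤ : LieIdeal K g), (⊤ : LieSubmodule K g M)⁆ := hm2
    rw [← hDc.sup_eq_top, LieSubmodule.lie_sup] at hm2'
    obtain ⟨u, hu, v, hv, huv⟩ := (LieSubmodule.mem_sup _ _ _).1 hm2'
    have hu' : u ∈ D.ker := LieSubmodule.lie_le_right _ _ hu
    have hv' : v ∈ D.range := LieSubmodule.lie_le_right _ _ hv
    have hv0 : v ∈ D.ker ⊓ D.range := by
      refine ⟨?_, hv'⟩
      have : v = m - u := by rw [← huv]; abel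
      rw [this]
      exact sub_mem hm hu'
    rw [hDc.inf_eq_bot] at hv0
    have hv00 : v = 0 := hv0
    rw [hv00, add_zero] at huv
    subst huv
    rw [hmap] at hu
    obtain ⟨w, hw, hwm⟩ := (LieSubmodule.mem_map _).1 hu
    have hw2 : w ∈ LieModule.maxTrivSubmodule K g D.ker := by
      intro x
      apply Subtype.ext
      have : (w : M) = u := hwm
      change ⁅x, (w : M)⁆ = 0
      rw [this]
      exact hm1 x
    have hw0 : w = 0 := LieSubmodule.mem_bot w |>.1 (hN.disjoint.le_bot ⟨hw2, hw⟩)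
    rw [← hwm, hw0]
    exact zero_mem _
  · rw [codisjoint_iff, eq_top_iff]
    refine hDc.sup_eq_top.ge.trans (sup_le ?_ (hrange.trans le_sup_right))
    intro m hm
    have h1 : (⟨m, hm⟩ : D.ker) ∈ LieModule.maxTrivSubmodule K g D.ker ⊔
      ⁅(⊤ : LieIdeal K g), (⊤ : LieSubmodule K g D.ker)⁆ := by
      rw [hN.sup_eq_top]
      exact LieSubmodule.mem_top _
    obtain ⟨u, hu, v, hv, huv⟩ := (LieSubmodule.mem_sup _ _ _).1 h1
    have : m = u + v := congrArg Subtype.val huv.symm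
    rw [this]
    refine (LieSubmodule.mem_sup _ _ _).2 ⟨u, fun x => congrArg Subtype.val (hu x), v, ?_, rfl⟩
    have : (v : M) ∈ ⁅(⊤ : LieIdeal K g), D.ker⁆ := by
      rw [hmap]
      exact LieSubmodule.mem_map_of_mem hv
    exact LieSubmodule.mono_lie_right _ le_top this

/-- A finite-dimensional module over a semisimple Lie algebra is the direct sum of its invariants
and of the span of all `⁅x, m⁆`. -/
theorem isCompl_maxTrivSubmodule [FiniteDimensional K M] :
    IsCompl (LieModule.maxTrivSubmodule K g M) ⁅(⊤ : LieIdeal K g), (⊤ : LieSubmodule K g M)⁆ :=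
  isCompl_maxTrivSubmodule_of_finrank_eq _ M rfl

end Weyl

section Average

variable {K g : Type*} [Field K] [LieRing g] [LieAlgebra K g]
variable {M M' : Type*} [AddCommGroup M] [Module K M] [LieRingModule g M] [LieModule K g M]
  [AddCommGroup M'] [Module K M'] [LieRingModule g M'] [LieModule K g M']

theorem map_mem_of_mem_top_lie {N : Type*} [AddCommGroup N] [Module K N] (T : M →ₗ[K] N)
    (S : Submodule K N) (hT : ∀ (x : g) m, T ⁅x, m⁆ ∈ S) {m : M}
    (hm : m ∈ ⁅(⊤ : LieIdeal K g), (⊤ : LieSubmodule K g M)⁆) : T m ∈ S := by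
  have h : m ∈ ⁅(⊤ : LieIdeal K g), (⊤ : LieSubmodule K g M)⁆.toSubmodule := hm
  rw [LieSubmodule.lieIdeal_oper_eq_linear_span'] at h
  have h2 : Submodule.span K {z : M | ∃ x ∈ (⊤ : LieIdeal K g), ∃ n ∈ (⊤ : LieSubmodule K g M),
      ⁅x, n⁆ = z} ≤ S.comap T := by
    rw [Submodule.span_le]
    rintro _ ⟨x, -, m, -, rfl⟩
    exact hT x m
  exact h2 h

theorem sum_lie_mem_top_lie {ι : Type*} [Fintype ι] (x : ι → g) (m : ι → M) :
    ∑ i, ⁅x i, m i⁆ ∈ ⁅(⊤ : LieIdeal K g), (⊤ : LieSubmodule K g M)⁆ :=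
  sum_mem fun i _ => lie_mem_top_lie (x i) (m i)

variable [CharZero K] [FiniteDimensional K g] [LieAlgebra.IsKilling K g] [FiniteDimensional K M]
  [FiniteDimensional K M']

variable (K g) in
theorem exists_average (m : M) : ∃ a : M, (∀ x : g, ⁅x, a⁆ = 0) ∧
    m - a ∈ ⁅(⊤ : LieIdeal K g), (⊤ : LieSubmodule K g M)⁆ := by
  have h : m ∈ LieModule.maxTrivSubmodule K g M ⊔
      ⁅(⊤ : LieIdeal K g), (⊤ : LieSubmodule K g M)⁆ := by
    rw [isCompl_maxTrivSubmodule.sup_eq_top]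
    exact LieSubmodule.mem_top _
  obtain ⟨a, ha, c, hc, rfl⟩ := (LieSubmodule.mem_sup _ _ _).1 h
  exact ⟨a, ha, by simpa using hc⟩

theorem eq_zero_of_mem_top_lie {m : M} (h : ∀ x : g, ⁅x, m⁆ = 0)
    (hm : m ∈ ⁅(⊤ : LieIdeal K g), (⊤ : LieSubmodule K g M)⁆) : m = 0 :=
  (LieSubmodule.mem_bot m).1 (isCompl_maxTrivSubmodule.disjoint.le_bot ⟨h, hm⟩)

theorem average_map (T : M →ₗ[K] M') (hT : ∀ (x : g) m, T ⁅x, m⁆ = ⁅x, T m⁆) {m a : M}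
    (ha : ∀ x : g, ⁅x, a⁆ = 0)
    (hma : m - a ∈ ⁅(⊤ : LieIdeal K g), (⊤ : LieSubmodule K g M)⁆) {c : M'}
    (hc : ∀ x : g, ⁅x, c⁆ = 0)
    (hmc : T m - c ∈ ⁅(⊤ : LieIdeal K g), (⊤ : LieSubmodule K g M')⁆) : T a = c := by
  rw [← sub_eq_zero]
  refine eq_zero_of_mem_top_lie (K := K) (g := g) (fun x => ?_) ?_
  · rw [lie_sub, hc, ← hT, ha, map_zero, sub_zero]
  · have h1 : T (m - a) ∈ ⁅(⊤ : LieIdeal K g), (⊤ : LieSubmodule K g M')⁆.toSubmodule :=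
      map_mem_of_mem_top_lie T _ (fun x m => by rw [hT]; exact lie_mem_top_lie _ _) hma
    have : T a - c = (T m - c) - T (m - a) := by rw [map_sub]; abel
    rw [this]
    exact sub_mem hmc h1

/-- The average of `m` is mapped to `T m` if the latter is invariant. -/
theorem average_map_eq (T : M →ₗ[K] M') (hT : ∀ (x : g) m, T ⁅x, m⁆ = ⁅x, T m⁆) {m a : M}
    (ha : ∀ x : g, ⁅x, a⁆ = 0)
    (hma : m - a ∈ ⁅(⊤ : LieIdeal K g), (⊤ : LieSubmodule K g M)⁆) {c : M'}
    (hc : ∀ x : g, ⁅x, c⁆ = 0) (hmc : T m = c) : T a = c :=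
  average_map T hT ha hma hc (by rw [hmc, sub_self]; exact zero_mem _)

end Average

set_option maxSynthPendingDepth 10

section Forms

variable {K g L : Type*} [Field K] [LieRing g] [LieAlgebra K g] [LieRing L] [LieAlgebra K L]

/-- The trilinear form `P (p x) ⁅p y, p z⁆`. -/
def pullback (P : g →ₗ[K] g →ₗ[K] K) (p : L →ₗ[K] g) : L →ₗ[K] L →ₗ[K] L →ₗ[K] K :=
  LinearMap.mk₂ K (fun x y => P (p x) ∘ₗ (LieAlgebra.ad K g (p y) : g →ₗ[K] g) ∘ₗ p)
    (by intros; ext; simp) (by intros; ext; simp) (by intros; ext; simp) (by intros; ext; simp)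

@[simp] theorem pullback_apply (P : g →ₗ[K] g →ₗ[K] K) (p : L →ₗ[K] g) (x y z : L) :
    pullback P p x y z = P (p x) ⁅p y, p z⁆ := rfl

/-- A quadrilinear form from its values. -/
def mk₄ (f : L → L → L → L → K)
    (h1 : ∀ y z t, IsLinearMap K fun x => f x y z t) (h2 : ∀ x z t, IsLinearMap K fun y => f x y z t)
    (h3 : ∀ x y t, IsLinearMap K fun z => f x y z t) (h4 : ∀ x y z, IsLinearMap K fun t => f x y z t) :
    L →ₗ[K] L →ₗ[K] L →ₗ[K] L →ₗ[K] K :=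
  LinearMap.mk₂ K (fun x y => LinearMap.mk₂ K (fun z t => f x y z t)
    (fun _ _ t => (h3 x y t).map_add _ _) (fun c _ t => (h3 x y t).map_smul c _)
    (fun z => (h4 x y z).map_add) (fun c z t => (h4 x y z).map_smul c t))
    (fun _ _ y => by ext z t; exact (h1 y z t).map_add _ _)
    (fun c _ y => by ext z t; exact (h1 y z t).map_smul c _)
    (fun x _ _ => by ext z t; exact (h2 x z t).map_add _ _)
    (fun c x _ => by ext z t; exact (h2 x z t).map_smul c _)

/-- The Chevalley-Eilenberg differential of a trilinear form. -/
def diff : (L →ₗ[K] L →ₗ[K] L →ₗ[K] K) →ₗ[K] (L →ₗ[K] L →ₗ[K] L →ₗ[K] L →ₗ[K] K) where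
  toFun f := mk₄ (fun x y z t => - f ⁅x, y⁆ z t + f ⁅x, z⁆ y t - f ⁅x, t⁆ y z - f ⁅y, z⁆ x t
      + f ⁅y, t⁆ x z - f ⁅z, t⁆ x y)
    (fun _ _ _ => ⟨by intros; simp; ring, by intros; simp; ring⟩)
    (fun _ _ _ => ⟨by intros; simp; ring, by intros; simp; ring⟩)
    (fun _ _ _ => ⟨by intros; simp; ring, by intros; simp; ring⟩)
    (fun _ _ _ => ⟨by intros; simp; ring, by intros; simp; ring⟩)
  map_add' f f' := by ext; simp [mk₄]; ring
  map_smul' c f := by ext; simp [mk₄]; ring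

theorem diff_apply (f : L →ₗ[K] L →ₗ[K] L →ₗ[K] K) (x y z t : L) :
    diff f x y z t = - f ⁅x, y⁆ z t + f ⁅x, z⁆ y t - f ⁅x, t⁆ y z - f ⁅y, z⁆ x t
      + f ⁅y, t⁆ x z - f ⁅z, t⁆ x y := rfl

/-- The wedge product of a linear form with a trilinear form. -/
def wedge (a : L →ₗ[K] K) (f : L →ₗ[K] L →ₗ[K] L →ₗ[K] K) :
    L →ₗ[K] L →ₗ[K] L →ₗ[K] L →ₗ[K] K :=
  mk₄ (fun x y z t => a x * f y z t - a y * f x z t + a z * f x y t - a t * f x y z)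
    (fun _ _ _ => ⟨by intros; simp; ring, by intros; simp; ring⟩)
    (fun _ _ _ => ⟨by intros; simp; ring, by intros; simp; ring⟩)
    (fun _ _ _ => ⟨by intros; simp; ring, by intros; simp; ring⟩)
    (fun _ _ _ => ⟨by intros; simp; ring, by intros; simp; ring⟩)

theorem wedge_apply (a : L →ₗ[K] K) (f : L →ₗ[K] L →ₗ[K] L →ₗ[K] K) (x y z t : L) :
    wedge a f x y z t = a x * f y z t - a y * f x z t + a z * f x y t - a t * f x y z := rfl

variable [LieRingModule g L] [LieModule K g L]

theorem lie_trilin_apply (x : g) (f : L →ₗ[K] L →ₗ[K] L →ₗ[K] K) (y z t : L) :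
    ⁅x, f⁆ y z t = - f ⁅x, y⁆ z t - f y ⁅x, z⁆ t - f y z ⁅x, t⁆ := by
  simp [LieHom.lie_apply]
  ring

theorem lie_quadrilin_apply (x : g) (f : L →ₗ[K] L →ₗ[K] L →ₗ[K] L →ₗ[K] K) (y z t u : L) :
    ⁅x, f⁆ y z t u = - f ⁅x, y⁆ z t u - f y ⁅x, z⁆ t u - f y z ⁅x, t⁆ u - f y z t ⁅x, u⁆ := by
  simp [LieHom.lie_apply]
  ring

theorem diff_lie (hder : ∀ (x : g) (a b : L), ⁅x, ⁅a, b⁆⁆ = ⁅⁅x, a⁆, b⁆ + ⁅a, ⁅x, b⁆⁆)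
    (x : g) (f : L →ₗ[K] L →ₗ[K] L →ₗ[K] K) : diff ⁅x, f⁆ = ⁅x, diff f⁆ := by
  ext y z t u
  rw [lie_quadrilin_apply]
  simp only [diff_apply, lie_trilin_apply, hder, map_add, LinearMap.add_apply]
  ring

end Forms

section Transgression

variable {K g L ι : Type*} [Field K] [LieRing g] [LieAlgebra K g] [LieRing L] [LieAlgebra K L]
  [LieRingModule g L] [LieModule K g L]

theorem cyclic_sum_eq_zero (P : g →ₗ[K] g →ₗ[K] K) (hP : ∀ x y z, P ⁅x, y⁆ z = P x ⁅y, z⁆)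
    (x y z t : g) : P ⁅x, y⁆ ⁅z, t⁆ - P ⁅x, z⁆ ⁅y, t⁆ + P ⁅x, t⁆ ⁅y, z⁆ = 0 := by
  rw [hP, hP, hP, ← map_sub, ← map_add, leibniz_lie y z t, ← lie_skew t ⁅y, z⁆]
  simp

theorem diff_pullback [Fintype ι] (b : Basis ι K g) (P : g →ₗ[K] g →ₗ[K] K) (p : L →ₗ[K] g)
    (hP : ∀ x y z, P ⁅x, y⁆ z = P x ⁅y, z⁆) (hPs : ∀ x y, P x y = P y x)
    (hp : ∀ x y : L, p ⁅x, y⁆ = p ⁅p x, y⁆ - p ⁅p y, x⁆ - ⁅p x, p y⁆)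
    (htr : ∀ x : L, ∑ i, b.coord i (p ⁅b i, x⁆) = 0) :
    diff (pullback P p) = ∑ i, ⁅b i, wedge (b.coord i ∘ₗ p) (pullback P p)⁆ := by
  ext x y z t
  have hΦ : ∀ (u : g) (Φ : g →ₗ[K] K), ∑ i, b.coord i u * Φ (b i) = Φ u := by
    intro u Φ
    conv_rhs => rw [← b.sum_repr u, map_sum]
    simp only [map_smul, smul_eq_mul, Basis.coord_apply]
  have h1 : ∀ (u : g) (x y z : L), ∑ i, b.coord i u * P (p ⁅b i, x⁆) ⁅p y, p z⁆ =
      P (p ⁅u, x⁆) ⁅p y, p z⁆ := fun u x y z =>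
    hΦ u (P.flip ⁅p y, p z⁆ ∘ₗ p ∘ₗ (LieModule.toEnd K g L : g →ₗ[K] Module.End K L).flip x)
  have h2 : ∀ (u : g) (x y z : L), ∑ i, b.coord i u * P (p y) ⁅p ⁅b i, x⁆, p z⁆ =
      - P (p ⁅u, x⁆) ⁅p y, p z⁆ := by
    intro u x y z
    rw [← h1, ← Finset.sum_neg_distrib]
    refine Finset.sum_congr rfl fun i _ => ?_
    rw [← hP, ← hP (p ⁅b i, x⁆), ← lie_skew (p y), map_neg, LinearMap.neg_apply]
    ring
  have h3 : ∀ (u : g) (x y z : L), ∑ i, b.coord i u * P (p y) ⁅p z, p ⁅b i, x⁆⁆ =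
      P (p ⁅u, x⁆) ⁅p y, p z⁆ := by
    intro u x y z
    rw [← h1]
    refine Finset.sum_congr rfl fun i _ => ?_
    rw [← hP, hPs (p ⁅b i, x⁆)]
  have h4 : ∀ (x : L) (c : K), ∑ i, b.coord i (p ⁅b i, x⁆) * c = 0 := fun x c => by
    rw [← Finset.sum_mul, htr, zero_mul]
  simp only [LinearMap.sum_apply, lie_quadrilin_apply, wedge_apply, pullback_apply,
    LinearMap.comp_apply, diff_apply, Finset.sum_sub_distrib, Finset.sum_add_distrib,
    Finset.sum_neg_distrib, h1, h2, h3, h4, hp, map_sub, LinearMap.sub_apply]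
  have h5 := cyclic_sum_eq_zero P hP (p x) (p y) (p z) (p t)
  have e1 := hPs ⁅p z, p t⁆ ⁅p x, p y⁆
  have e2 := hPs ⁅p y, p t⁆ ⁅p x, p z⁆
  have e3 := hPs ⁅p y, p z⁆ ⁅p x, p t⁆
  linear_combination 2 * h5 + e1 - e2 + e3

end Transgression

section Cocycle

variable {K g L : Type*} [Field K] [LieRing g] [LieAlgebra K g] [LieRing L] [LieAlgebra K L]
  [LieRingModule g L] [LieModule K g L]

theorem lie_pullback (P : g →ₗ[K] g →ₗ[K] K) (p : L →ₗ[K] g)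
    (hp : ∀ (x : g) (y : L), p ⁅x, y⁆ = ⁅x, p y⁆)
    (hP : ∀ x y z, P ⁅x, y⁆ z = P x ⁅y, z⁆) (x : g) : ⁅x, pullback P p⁆ = 0 := by
  ext y z t
  have h : P ⁅x, p y⁆ ⁅p z, p t⁆ = - P (p y) ⁅x, ⁅p z, p t⁆⁆ := by
    rw [← lie_skew, map_neg, LinearMap.neg_apply, hP]
  rw [lie_trilin_apply]
  simp only [pullback_apply, hp, h, leibniz_lie x, map_add, LinearMap.zero_apply]
  ring

theorem diff_pullback_mem [FiniteDimensional K g] (P : g →ₗ[K] g →ₗ[K] K) (p : L →ₗ[K] g)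
    (hP : ∀ x y z, P ⁅x, y⁆ z = P x ⁅y, z⁆) (hPs : ∀ x y, P x y = P y x)
    (hp : ∀ x y : L, p ⁅x, y⁆ = p ⁅p x, y⁆ - p ⁅p y, x⁆ - ⁅p x, p y⁆)
    (htr : ∀ x : L, LinearMap.trace K g
      (p ∘ₗ (LieModule.toEnd K g L : g →ₗ[K] Module.End K L).flip x) = 0) :
    diff (pullback P p) ∈ ⁅(⊤ : LieIdeal K g),
      (⊤ : LieSubmodule K g (L →ₗ[K] L →ₗ[K] L →ₗ[K] L →ₗ[K] K))⁆ := by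
  let b := Module.finBasis K g
  rw [diff_pullback b P p hP hPs hp]
  · apply sum_lie_mem_top_lie
  · intro x
    rw [← htr x, LinearMap.trace_eq_matrix_trace K b, Matrix.trace]
    simp [LinearMap.toMatrix_apply]

theorem exists_invariant_cocycle [CharZero K] [FiniteDimensional K g] [LieAlgebra.IsKilling K g]
    [FiniteDimensional K L] (P : g →ₗ[K] g →ₗ[K] K) (p : L →ₗ[K] g) (θ : g →ₗ[K] L)
    (hder : ∀ (x : g) (a b : L), ⁅x, ⁅a, b⁆⁆ = ⁅⁅x, a⁆, b⁆ + ⁅a, ⁅x, b⁆⁆)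
    (hθ : ∀ x y : g, ⁅x, θ y⁆ = θ ⁅x, y⁆) (hpθ : ∀ x, p (θ x) = x)
    (hP : ∀ x y z, P ⁅x, y⁆ z = P x ⁅y, z⁆) (hPs : ∀ x y, P x y = P y x)
    (hp : ∀ x y : L, p ⁅x, y⁆ = p ⁅p x, y⁆ - p ⁅p y, x⁆ - ⁅p x, p y⁆)
    (htr : ∀ x : L, LinearMap.trace K g
      (p ∘ₗ (LieModule.toEnd K g L : g →ₗ[K] Module.End K L).flip x) = 0) :
    ∃ δ : L →ₗ[K] L →ₗ[K] L →ₗ[K] K, (∀ x : g, ⁅x, δ⁆ = 0) ∧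
      (∀ l : (L →ₗ[K] L →ₗ[K] L →ₗ[K] K) →ₗ[K] K, (∀ (x : g) f, l ⁅x, f⁆ = 0) →
        l δ = l (pullback P p)) ∧
      diff δ = 0 ∧ (∀ x y z, δ y x z = - δ x y z) ∧ (∀ x y z, δ x z y = - δ x y z) ∧
      ∀ x y z, δ (θ x) (θ y) (θ z) = P x ⁅y, z⁆ := by
  obtain ⟨δ, hδ, hδm⟩ := exists_average K g (pullback P p)
  refine ⟨δ, hδ, fun l hl => ?_, ?_, fun x y z => ?_, fun x y z => ?_, fun x y z => ?_⟩
  · have := map_mem_of_mem_top_lie (g := g) l ⊥ (fun x f => hl x f) hδm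
    rw [Submodule.mem_bot, map_sub, sub_eq_zero] at this
    exact this.symm
  · refine average_map (K := K) (g := g) (M := L →ₗ[K] L →ₗ[K] L →ₗ[K] K)
      (M' := L →ₗ[K] L →ₗ[K] L →ₗ[K] L →ₗ[K] K) diff (diff_lie hder) hδ hδm
      (fun x => lie_zero x) ?_
    rw [sub_zero]
    exact diff_pullback_mem P p hP hPs hp htr
  · let T : (L →ₗ[K] L →ₗ[K] L →ₗ[K] K) →ₗ[K] (L →ₗ[K] L →ₗ[K] L →ₗ[K] K) :=
      { toFun f := f + f.flip
        map_add' f f' := by ext; simp; ring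
        map_smul' c f := by ext; simp }
    have h := average_map_eq (g := g) T (fun x f => by
      ext y z t
      rw [lie_trilin_apply]
      simp only [T, LinearMap.coe_mk, AddHom.coe_mk, LinearMap.add_apply, LinearMap.flip_apply,
        lie_trilin_apply]
      ring) hδ hδm (fun x => lie_zero x) (by
      ext y z t
      simp only [T, LinearMap.coe_mk, AddHom.coe_mk, LinearMap.add_apply, LinearMap.flip_apply,
        pullback_apply, LinearMap.zero_apply]
      rw [← hP, ← hP, ← lie_skew, map_neg, LinearMap.neg_apply]
      ring)
    have h2 := congrArg (fun f => f x y z) h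
    simp only [T, LinearMap.coe_mk, AddHom.coe_mk, LinearMap.add_apply, LinearMap.flip_apply,
      LinearMap.zero_apply] at h2
    linear_combination h2
  · let flip₂ : (L →ₗ[K] L →ₗ[K] K) →ₗ[K] (L →ₗ[K] L →ₗ[K] K) :=
      LinearMap.lflip.toLinearMap
    have flip₂_apply : ∀ f x y, flip₂ f x y = f y x := fun _ _ _ => rfl
    let T : (L →ₗ[K] L →ₗ[K] L →ₗ[K] K) →ₗ[K] (L →ₗ[K] L →ₗ[K] L →ₗ[K] K) :=
      { toFun f := f + flip₂ ∘ₗ f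
        map_add' f f' := by ext; simp; ring
        map_smul' c f := by ext; simp }
    have h := average_map_eq (g := g) T (fun x f => by
      ext y z t
      rw [lie_trilin_apply]
      simp only [T, LinearMap.coe_mk, AddHom.coe_mk, LinearMap.add_apply, LinearMap.comp_apply,
        flip₂_apply, lie_trilin_apply]
      ring) hδ hδm (fun x => lie_zero x) (by
      ext y z t
      simp only [T, LinearMap.coe_mk, AddHom.coe_mk, LinearMap.add_apply, LinearMap.comp_apply,
        flip₂_apply, pullback_apply, LinearMap.zero_apply]
      rw [← lie_skew, map_neg]
      ring)
    have h2 := congrArg (fun f => f x y z) h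
    simp only [T, LinearMap.coe_mk, AddHom.coe_mk, LinearMap.add_apply, LinearMap.comp_apply,
      flip₂_apply, LinearMap.zero_apply] at h2
    linear_combination h2
  · let T : (L →ₗ[K] L →ₗ[K] L →ₗ[K] K) →ₗ[K] (g →ₗ[K] g →ₗ[K] g →ₗ[K] K) :=
      { toFun f := (f.compl₁₂ θ θ).compr₂ (LinearMap.lcomp K K θ)
        map_add' f f' := by ext; simp
        map_smul' c f := by ext; simp }
    have hT : T (pullback P p) = pullback P LinearMap.id := by
      ext y z t
      simp [T, hpθ]
    have h := average_map_eq (g := g) T (c := pullback P LinearMap.id) (fun x f => by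
      ext y z t
      rw [lie_trilin_apply]
      simp only [T, LinearMap.coe_mk, AddHom.coe_mk, LinearMap.compr₂_apply,
        LinearMap.compl₁₂_apply, LinearMap.lcomp_apply, lie_trilin_apply, hθ]) hδ hδm
      (lie_pullback P LinearMap.id (fun _ _ => rfl) hP) hT
    exact congrArg (fun f => f x y z) h

end Cocycle

section InvariantPair

variable (K : Type*) {L ι : Type*} [Field K] [LieRing L] [LieAlgebra K L] [Fintype ι]

/-- The tensor `∑ i, e i ⊗ e' i` is invariant. -/
def IsInvariantPair (e e' : ι → L) : Prop :=
  ∀ (x : L) (F : L →ₗ[K] L →ₗ[K] K), ∑ i, (F ⁅x, e i⁆ (e' i) + F (e i) ⁅x, e' i⁆) = 0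

variable {K}

theorem IsInvariantPair.symm {e e' : ι → L} (h : IsInvariantPair K e e') :
    IsInvariantPair K e' e := by
  intro x F
  rw [← h x F.flip]
  exact Finset.sum_congr rfl fun i _ => add_comm _ _

/-- The contraction `∑ f ⁅ε' j, e i⁆ (e' i) (ε j)`. -/
def contraction (e e' ε ε' : ι → L) : (L →ₗ[K] L →ₗ[K] L →ₗ[K] K) →ₗ[K] K where
  toFun f := ∑ j, ∑ i, f ⁅ε' j, e i⁆ (e' i) (ε j)
  map_add' f f' := by simp [Finset.sum_add_distrib]
  map_smul' c f := by simp [Finset.mul_sum]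

theorem contraction_apply (e e' ε ε' : ι → L) (f : L →ₗ[K] L →ₗ[K] L →ₗ[K] K) :
    contraction e e' ε ε' f = ∑ j, ∑ i, f ⁅ε' j, e i⁆ (e' i) (ε j) := rfl

theorem contraction_lie {g : Type*} [LieRing g] [LieAlgebra K g] [LieRingModule g L]
    [LieModule K g L] (θ : g → L) (hθ : ∀ (x : g) (a : L), ⁅x, a⁆ = ⁅θ x, a⁆)
    {e e' ε ε' : ι → L} (h : IsInvariantPair K e e') (h' : IsInvariantPair K ε ε')
    (x : g) (f : L →ₗ[K] L →ₗ[K] L →ₗ[K] K) : contraction e e' ε ε' ⁅x, f⁆ = 0 := by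
  let F : L →ₗ[K] L →ₗ[K] K := LinearMap.mk₂ K (fun u v => ∑ i, f ⁅v, e i⁆ (e' i) u)
    (by intros; simp [Finset.sum_add_distrib]) (by intros; simp [Finset.mul_sum])
    (by intros; simp [Finset.sum_add_distrib]) (by intros; simp [Finset.mul_sum])
  have h1 : ∑ j, (∑ i, f ⁅ε' j, e i⁆ (e' i) ⁅θ x, ε j⁆ +
      ∑ i, f ⁅⁅θ x, ε' j⁆, e i⁆ (e' i) (ε j)) = 0 := h' (θ x) F
  have h2 : ∀ j, ∑ i, (f ⁅ε' j, ⁅θ x, e i⁆⁆ (e' i) (ε j) +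
      f ⁅ε' j, e i⁆ ⁅θ x, e' i⁆ (ε j)) = 0 := fun j =>
    h (θ x) (LinearMap.mk₂ K (fun u v => f ⁅ε' j, u⁆ v (ε j)) (by intros; simp)
      (by intros; simp) (by intros; simp) (by intros; simp))
  rw [contraction_apply, ← neg_eq_zero, ← h1, ← Finset.sum_neg_distrib]
  refine Finset.sum_congr rfl fun j _ => ?_
  rw [← sub_eq_zero, ← h2 j, ← Finset.sum_add_distrib, ← Finset.sum_neg_distrib,
    ← Finset.sum_sub_distrib]
  refine Finset.sum_congr rfl fun i _ => ?_
  simp only [lie_trilin_apply, hθ, leibniz_lie (θ x), map_add, LinearMap.add_apply]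
  ring

end InvariantPair

section InvariantForm

variable {K g L ι : Type*} [Field K] [LieRing g] [LieAlgebra K g] [LieRing L] [LieAlgebra K L]
  [LieRingModule g L] [LieModule K g L] [Fintype ι]

/-- The bilinear form `∑ δ ⁅w, e i⁆ (e' i) y`. -/
def transgress (δ : L →ₗ[K] L →ₗ[K] L →ₗ[K] K) (e e' : ι → L) : L →ₗ[K] L →ₗ[K] K :=
  LinearMap.mk₂ K (fun y w => ∑ i, δ ⁅w, e i⁆ (e' i) y)
    (by intros; simp [Finset.sum_add_distrib]) (by intros; simp [Finset.mul_sum])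
    (by intros; simp [Finset.sum_add_distrib]) (by intros; simp [Finset.mul_sum])

theorem transgress_apply (δ : L →ₗ[K] L →ₗ[K] L →ₗ[K] K) (e e' : ι → L) (y w : L) :
    transgress δ e e' y w = ∑ i, δ ⁅w, e i⁆ (e' i) y := rfl

/-- A closed trilinear form is determined by its transgression. -/
theorem eq_transgress {δ : L →ₗ[K] L →ₗ[K] L →ₗ[K] K} {e e' : ι → L}
    (he : IsInvariantPair K e e') (hcas : ∀ w : L, ∑ i, ⁅e' i, ⁅e i, w⁆⁆ = w) (hd : diff δ = 0)
    (h12 : ∀ x y z, δ y x z = - δ x y z) (h23 : ∀ x y z, δ x z y = - δ x y z) (w y z : L) :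
    δ w y z = transgress δ e e' z ⁅w, y⁆ - transgress δ e e' y ⁅w, z⁆ -
      transgress δ e e' ⁅y, z⁆ w := by
  have h1 : ∑ i, δ ⁅⁅w, e i⁆, e' i⁆ y z = δ w y z := by
    conv_rhs => rw [← hcas w]
    simp only [map_sum, LinearMap.sum_apply]
    refine Finset.sum_congr rfl fun i _ => ?_
    rw [← lie_skew, ← lie_skew w, lie_neg, neg_neg]
  have h2 : ∀ y z, ∑ i, (δ ⁅⁅w, e i⁆, y⁆ (e' i) z - δ ⁅e' i, y⁆ ⁅w, e i⁆ z) =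
      transgress δ e e' z ⁅w, y⁆ := by
    intro y z
    have h := he y (LinearMap.mk₂ K (fun u v => δ ⁅w, u⁆ v z) (by intros; simp)
      (by intros; simp) (by intros; simp) (by intros; simp))
    rw [transgress_apply, ← sub_eq_zero, ← neg_eq_zero, ← h, ← Finset.sum_sub_distrib,
      ← Finset.sum_neg_distrib]
    refine Finset.sum_congr rfl fun i _ => ?_
    have e1 : ⁅⁅w, e i⁆, y⁆ = ⁅⁅w, y⁆, e i⁆ - ⁅w, ⁅y, e i⁆⁆ := by
      rw [leibniz_lie w y, ← lie_skew _ ⁅w, e i⁆]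
      abel
    rw [e1, h12 ⁅w, e i⁆, ← lie_skew (e' i) y]
    simp only [map_sub, map_neg, LinearMap.sub_apply, LinearMap.neg_apply, LinearMap.mk₂_apply]
    ring
  have h3 : ∑ i, diff δ ⁅w, e i⁆ (e' i) y z = 0 := by simp [hd]
  have h4 : transgress δ e e' ⁅y, z⁆ w = ∑ i, δ ⁅y, z⁆ ⁅w, e i⁆ (e' i) := by
    rw [transgress_apply]
    refine Finset.sum_congr rfl fun i _ => ?_
    linear_combination h23 ⁅w, e i⁆ (e' i) ⁅y, z⁆ - h12 ⁅w, e i⁆ ⁅y, z⁆ (e' i)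
  rw [← h2 y z, ← h2 z y, ← h1, h4, ← sub_eq_zero, ← neg_eq_zero, ← h3,
    ← Finset.sum_sub_distrib, ← Finset.sum_sub_distrib, ← Finset.sum_sub_distrib,
    ← Finset.sum_neg_distrib]
  refine Finset.sum_congr rfl fun i _ => ?_
  rw [diff_apply]
  ring

theorem transgress_lie (θ : g → L) (hθ : ∀ (x : g) (a : L), ⁅x, a⁆ = ⁅θ x, a⁆)
    {δ : L →ₗ[K] L →ₗ[K] L →ₗ[K] K} {e e' : ι → L}
    (he : IsInvariantPair K e e') (hδ : ∀ x : g, ⁅x, δ⁆ = 0) (x : g) (y w : L) :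
    transgress δ e e' ⁅θ x, y⁆ w + transgress δ e e' y ⁅θ x, w⁆ = 0 := by
  have h := he (θ x) (LinearMap.mk₂ K (fun u v => δ ⁅w, u⁆ v y) (by intros; simp)
      (by intros; simp) (by intros; simp) (by intros; simp))
  have h2 : ∀ i, ⁅x, δ⁆ ⁅w, e i⁆ (e' i) y = 0 := fun i => by rw [hδ]; rfl
  have h3 : ∑ i, ⁅x, δ⁆ ⁅w, e i⁆ (e' i) y = 0 := Finset.sum_eq_zero fun i _ => h2 i
  rw [← neg_eq_zero, ← h3, ← sub_eq_zero, ← h, transgress_apply, transgress_apply,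
    ← Finset.sum_add_distrib, ← Finset.sum_neg_distrib, ← Finset.sum_sub_distrib]
  refine Finset.sum_congr rfl fun i _ => ?_
  simp only [lie_trilin_apply, hθ, leibniz_lie (θ x) w, map_add, LinearMap.add_apply,
    LinearMap.mk₂_apply]
  ring

theorem exists_invariant_form [CharZero K] [Module.Finite K g] [IsKilling K g]
    [Module.Finite K L] (P : g →ₗ[K] g →ₗ[K] K) (p : L →ₗ[K] g) (θ : g →ₗ[K] L)
    (hθL : ∀ (x : g) (a : L), ⁅x, a⁆ = ⁅θ x, a⁆)
    (hθ : ∀ x y : g, ⁅x, θ y⁆ = θ ⁅x, y⁆) (hpθ : ∀ x, p (θ x) = x)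
    (hP : ∀ x y z, P ⁅x, y⁆ z = P x ⁅y, z⁆) (hPs : ∀ x y, P x y = P y x)
    (hp : ∀ x y : L, p ⁅x, y⁆ = p ⁅p x, y⁆ - p ⁅p y, x⁆ - ⁅p x, p y⁆)
    (htr : ∀ x : L, LinearMap.trace K g
      (p ∘ₗ (LieModule.toEnd K g L : g →ₗ[K] Module.End K L).flip x) = 0)
    {e e' : ι → L} (he : IsInvariantPair K e e')
    (hcas : ∀ w : L, ∑ i, ⁅e' i, ⁅e i, w⁆⁆ = w)
    (hc : contraction e e' e e' (pullback P p) = 0)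
    (hc' : contraction e e' e' e (pullback P p) = 0) :
    ∃ s : L →ₗ[K] L →ₗ[K] K, (∀ x y z, s ⁅x, y⁆ z = s x ⁅y, z⁆) ∧ (∀ x y, s x y = s y x) ∧
      (∀ x y, 2 * P x y = s (θ x) (θ y)) ∧ ∑ j, s (e j) (e' j) = 0 := by
  obtain ⟨δ, h0, hl, hd, h12, h23, hδθ⟩ := exists_invariant_cocycle P p θ
    (fun x a b => by simp only [hθL, leibniz_lie (θ x)]) hθ hpθ hP hPs hp htr
  set r := transgress δ e e' with hr
  have hδ : ∀ w y z, δ w y z = r z ⁅w, y⁆ - r y ⁅w, z⁆ - r ⁅y, z⁆ w := eq_transgress he hcas hd h12 h23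
  have hrθ : ∀ (x : g) (y w : L), r ⁅θ x, y⁆ w + r y ⁅θ x, w⁆ = 0 := transgress_lie θ hθL he h0
  have hθ' : ∀ x y : g, ⁅θ x, θ y⁆ = θ ⁅x, y⁆ := fun x y => by rw [← hθL, hθ]
  have hPr : ∀ x y, P x y = r (θ y) (θ x) := by
    intro x y
    have : P.flip = r.compl₁₂ θ θ := by
      refine linearMap_ext_lie (K := K) fun y z => ?_
      ext w
      have h1 := hδθ w y z
      rw [hδ] at h1
      have h2 := hrθ y (θ z) (θ w)
      have h3 := hrθ z (θ y) (θ w)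
      rw [← lie_skew (θ z) (θ y), ← lie_skew (θ z) (θ w)] at h3
      rw [← lie_skew (θ y) (θ w)] at h2
      simp only [map_neg, LinearMap.neg_apply, hθ'] at h1 h2 h3
      simp only [LinearMap.flip_apply, LinearMap.compl₁₂_apply]
      linear_combination h3 - h2 - h1
    exact congrArg (fun f => f y x) this
  refine ⟨r + r.flip, ?_, fun x y => ?_, fun x y => ?_, ?_⟩
  · intro x y z
    have h1 := h12 z x y
    simp only [hδ] at h1
    rw [← lie_skew x z, ← lie_skew z y] at h1
    simp only [LinearMap.add_apply, LinearMap.flip_apply, map_neg, LinearMap.neg_apply] at h1 ⊢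
    linear_combination -h1
  · simp only [LinearMap.add_apply, LinearMap.flip_apply]
    ring
  · simp only [LinearMap.add_apply, LinearMap.flip_apply]
    rw [← hPr, ← hPr, hPs y x]
    ring
  · simp only [LinearMap.add_apply, LinearMap.flip_apply, Finset.sum_add_distrib]
    have h1 := hl (contraction e e' e e') (contraction_lie θ hθL he he)
    have h2 := hl (contraction e e' e' e) (contraction_lie θ hθL he he.symm)
    rw [hc] at h1
    rw [hc'] at h2
    exact (congrArg₂ (· + ·) h1 h2).trans (add_zero 0)

end InvariantForm

section KillingForm

variable {K n ι : Type*} [Field K] [LieRing n] [LieAlgebra K n] [Module.Finite K n]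

theorem trace_ad_eq_zero [CharZero K] [IsKilling K n] (x : n) :
    LinearMap.trace K n (ad K n x) = 0 := by
  have h : LinearMap.trace K n ∘ₗ (ad K n : n →ₗ[K] Module.End K n) = 0 :=
    linearMap_ext_lie (K := K) fun x y => by simp [LieHom.map_lie]
  exact congrArg (fun f => f x) h

theorem dualBasis_apply_eq_repr [Finite ι] [DecidableEq ι] (B : LinearMap.BilinForm K n)
    (hB : B.Nondegenerate) (b : Basis ι K n) (i : ι) (u : n) :
    B (B.dualBasis hB b i) u = b.repr u i := by
  have h : B (B.dualBasis hB b i) = b.coord i := b.ext fun j => by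
    simp [LinearMap.BilinForm.apply_dualBasis_left, Finsupp.single_apply]
  rw [h, Basis.coord_apply]

theorem killingForm_lie_left (x y z : n) : killingForm K n ⁅x, y⁆ z = - killingForm K n y ⁅x, z⁆ := by
  rw [← lie_skew, map_neg, LinearMap.neg_apply, LieModule.traceForm_apply_lie_apply]

/-- The Casimir element of the Killing form acts as the identity. -/
theorem sum_lie_lie_dualBasis [CharZero K] [Fintype ι] [DecidableEq ι]
    (hκ : (killingForm K n).Nondegenerate) (b : Basis ι K n) (w : n) :
    ∑ i, ⁅(killingForm K n).dualBasis hκ b i, ⁅b i, w⁆⁆ = w := by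
  rw [← sub_eq_zero]
  refine hκ.1 _ fun v => ?_
  rw [map_sub, LinearMap.sub_apply, map_sum, LinearMap.sum_apply, sub_eq_zero,
    LieModule.traceForm_comm K n n w v, LieModule.traceForm_apply_apply,
    LinearMap.trace_eq_matrix_trace K b, Matrix.trace]
  refine Finset.sum_congr rfl fun i _ => ?_
  rw [LieModule.traceForm_apply_lie_apply, dualBasis_apply_eq_repr, Matrix.diag_apply,
    LinearMap.toMatrix_apply, ← lie_skew, ← lie_skew (b i) w, lie_neg, neg_neg]
  rfl

omit [Module.Finite K n] in
variable (K n) in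
theorem nontrivial_of_isSimple [IsSimple K n] : Nontrivial n := by
  by_contra h
  rw [not_nontrivial_iff_subsingleton] at h
  exact IsSimple.non_abelian K (L := n) ⟨fun _ _ => Subsingleton.elim _ _⟩

/-- Schur's lemma for invariant bilinear forms. -/
theorem exists_eq_smul_killingForm [CharZero K] [IsAlgClosed K] [IsSimple K n]
    (s : n →ₗ[K] n →ₗ[K] K) (hs : ∀ x y z, s ⁅x, y⁆ z = s x ⁅y, z⁆) :
    ∃ c : K, s = c • killingForm K n := by
  have hκ := IsKilling.killingForm_nondegenerate K n
  have : Nontrivial n := nontrivial_of_isSimple K n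
  let T : Module.End K n := (LinearMap.BilinForm.toDual _ hκ).symm.toLinearMap ∘ₗ s
  have hT : ∀ x y, killingForm K n (T x) y = s x y := fun x y => by
    have h := LinearMap.BilinForm.toDual_def (B := killingForm K n) (m := T x) (n := y) hκ
    rw [← h]
    simp [T]
  obtain ⟨c, hc⟩ := Module.End.exists_eigenvalue T
  obtain ⟨v, hv⟩ := hc.exists_hasEigenvector
  let I : LieIdeal K n :=
    { LinearMap.ker (s - c • killingForm K n) with
      lie_mem := by
        intro x m hm
        have hm' : (s - c • killingForm K n) m = 0 := hm
        change (s - c • killingForm K n) ⁅x, m⁆ = 0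
        ext y
        have h := congrArg (fun f => f ⁅x, y⁆) hm'
        have h2 := killingForm_lie_left (K := K) x m y
        have h3 := hs m x y
        rw [← lie_skew, map_neg, LinearMap.neg_apply] at h3
        simp only [LinearMap.sub_apply, LinearMap.smul_apply, LinearMap.zero_apply, h2,
          smul_eq_mul] at h ⊢
        linear_combination -h3 - h }
  have hI : ∀ m, m ∈ I ↔ (s - c • killingForm K n) m = 0 := fun m => Iff.rfl
  have hvI : v ∈ I := by
    rw [hI]
    ext y
    rw [LinearMap.sub_apply, LinearMap.sub_apply, ← hT, hv.apply_eq_smul]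
    simp
  refine ⟨c, ?_⟩
  rcases IsSimple.eq_bot_or_eq_top (R := K) I with h | h
  · rw [h] at hvI
    exact absurd hvI hv.2
  · ext x y
    have hx : x ∈ I := h ▸ LieSubmodule.mem_top x
    rw [hI] at hx
    have h' := congrArg (fun f => f y) hx
    simpa [sub_eq_zero] using h'

end KillingForm

section Prod

variable {K g n ι : Type*} [Field K] [CharZero K] [LieRing g] [LieAlgebra K g] [Module.Finite K g]
  [LieRing n] [LieAlgebra K n] [Module.Finite K n]

/-- Two copies of a family, in the factors of the product. -/
def double (b : ι → n) : ι ⊕ ι → n × n := Sum.elim (fun i => (b i, 0)) (fun i => (0, b i))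

theorem isInvariantPair_double [Fintype ι] [DecidableEq ι] (hκ : (killingForm K n).Nondegenerate)
    (b : Basis ι K n) :
    IsInvariantPair K (double b) (double ((killingForm K n).dualBasis hκ b)) := by
  intro x F
  have h1 := sum_dualBasis_invariant _ hκ killingForm_lie_left b x.1
    (F.compl₁₂ (LinearMap.inl K n n) (LinearMap.inl K n n))
  have h2 := sum_dualBasis_invariant _ hκ killingForm_lie_left b x.2
    (F.compl₁₂ (LinearMap.inr K n n) (LinearMap.inr K n n))
  rw [Fintype.sum_sum_type]
  refine Eq.trans ?_ ((congrArg₂ (· + ·) h1 h2).trans (add_zero 0))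
  simp [double]

theorem sum_lie_lie_double [Fintype ι] [DecidableEq ι] (hκ : (killingForm K n).Nondegenerate)
    (b : Basis ι K n) (w : n × n) :
    ∑ i, ⁅double ((killingForm K n).dualBasis hκ b) i, ⁅double b i, w⁆⁆ = w := by
  have h1 := sum_lie_lie_dualBasis hκ b w.1
  have h2 := sum_lie_lie_dualBasis hκ b w.2
  rw [Fintype.sum_sum_type]
  ext
  · simpa [double, Prod.fst_sum] using h1
  · simpa [double, Prod.snd_sum] using h2

theorem contraction_double_pullback [Fintype ι] (P : g →ₗ[K] g →ₗ[K] K) (q : n →ₗ[K] g)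
    (e e' ε ε' : ι → n) :
    contraction (double e) (double e') (double ε) (double ε')
      (pullback P (q ∘ₗ (LinearMap.snd K n n - LinearMap.fst K n n))) = 0 := by
  rw [contraction_apply]
  simp [double]

variable [IsKilling K g] [IsSimple K n] [IsAlgClosed K]

theorem exists_smul_eq (φ ψ : g →ₗ⁅K⁆ n) (σ : g ≃ₗ[K] n) (hσ : ∀ x, σ x = ψ x - φ x)
    (P : g →ₗ[K] g →ₗ[K] K) (hP : ∀ x y z, P ⁅x, y⁆ z = P x ⁅y, z⁆)
    (hPs : ∀ x y, P x y = P y x) :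
    ∃ c : K, ∀ x y,
      2 * P x y = c * (killingForm K n (φ x) (φ y) - killingForm K n (ψ x) (ψ y)) := by
  classical
  have hκ := IsKilling.killingForm_nondegenerate K n
  let b := Module.finBasis K n
  let θ : g →ₗ⁅K⁆ n × n := φ.prod ψ
  let p : n × n →ₗ[K] g := σ.symm.toLinearMap ∘ₗ (LinearMap.snd K n n - LinearMap.fst K n n)
  let _ : LieRingModule g (n × n) := LieRingModule.compLieHom (n × n) θ
  have _ : LieModule K g (n × n) := LieModule.compLieHom (n × n) θ
  have hθL : ∀ (x : g) (a : n × n), ⁅x, a⁆ = ⁅θ x, a⁆ := fun _ _ => rfl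
  have hθx : ∀ x, θ x = (φ x, ψ x) := fun _ => rfl
  have hpx : ∀ a, p a = σ.symm (a.2 - a.1) := fun _ => rfl
  have hpθ : ∀ x, p (θ x) = x := fun x => by rw [hpx, hθx, ← hσ, σ.symm_apply_apply]
  have hdec : ∀ a : n × n, ∃ x c, a = θ x + (c, c) := fun a =>
    ⟨p a, a.1 - φ (p a), by
      have h := hσ (p a)
      rw [hpx, σ.apply_symm_apply] at h
      rw [hθx]
      ext
      · simp
      · simp only [Prod.snd_add]
        rw [hpx, ← sub_eq_zero]
        rw [← sub_eq_zero] at h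
        rw [← h]
        abel⟩
  have hpc : ∀ c : n, p (c, c) = 0 := fun c => by simp [hpx]
  have hp : ∀ x y : n × n, p ⁅x, y⁆ = p ⁅p x, y⁆ - p ⁅p y, x⁆ - ⁅p x, p y⁆ := by
    intro x y
    obtain ⟨u, c, rfl⟩ := hdec x
    obtain ⟨v, d, rfl⟩ := hdec y
    simp only [map_add, hpθ, hpc, add_zero]
    have huv : ⁅u, v⁆ = σ.symm (⁅ψ u, ψ v⁆ - ⁅φ u, φ v⁆) := by
      rw [← LieHom.map_lie, ← LieHom.map_lie, ← hσ, σ.symm_apply_apply]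
    simp only [hθL, hθx, hpx, huv, ← map_sub]
    congr 1
    simp only [LieAlgebra.Prod.bracket_apply, Prod.fst_add, Prod.snd_add, lie_add, add_lie]
    rw [← lie_skew (ψ v) c, ← lie_skew (φ v) c, ← lie_skew (ψ v) (ψ u), ← lie_skew (φ v) (φ u)]
    abel
  have htr : ∀ x : n × n, LinearMap.trace K g
      (p ∘ₗ (LieModule.toEnd K g (n × n) : g →ₗ[K] Module.End K (n × n)).flip x) = 0 := by
    intro x
    obtain ⟨u, c, rfl⟩ := hdec x
    have h : p ∘ₗ (LieModule.toEnd K g (n × n) : g →ₗ[K] Module.End K (n × n)).flip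
        (θ u + (c, c)) = - ad K g u - σ.symm.conj (ad K n c) := by
      ext z
      have h1 : p ⁅θ z, (c, c)⁆ = - σ.symm ⁅c, σ z⁆ := by
        rw [hpx, hθx, LieAlgebra.Prod.bracket_apply, ← sub_lie, ← hσ, ← lie_skew, map_neg]
      change p ⁅θ z, θ u + (c, c)⁆ = - ⁅u, z⁆ - σ.symm ⁅c, σ z⁆
      rw [lie_add, map_add, h1, ← LieHom.map_lie, hpθ, ← lie_skew, sub_eq_add_neg]
    rw [h, map_sub, LinearMap.trace_conj', map_neg, trace_ad_eq_zero, trace_ad_eq_zero]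
    simp
  obtain ⟨s, hs, hss, hsP, hstr⟩ := exists_invariant_form P p (θ : g →ₗ[K] n × n) hθL
    (fun x y => by rw [hθL]; exact (θ.map_lie x y).symm) hpθ hP hPs hp htr
    (isInvariantPair_double hκ b) (sum_lie_lie_double hκ b)
    (contraction_double_pullback P _ _ _ _ _) (contraction_double_pullback P _ _ _ _ _)
  obtain ⟨α, hα⟩ := exists_eq_smul_killingForm
    (s.compl₁₂ (LinearMap.inl K n n) (LinearMap.inl K n n)) fun x y z => by
      simpa using hs (x, 0) (y, 0) (z, 0)
  obtain ⟨β, hβ⟩ := exists_eq_smul_killingForm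
    (s.compl₁₂ (LinearMap.inr K n n) (LinearMap.inr K n n)) fun x y z => by
      simpa using hs (0, x) (0, y) (0, z)
  have hcross : s.compl₁₂ (LinearMap.inl K n n) (LinearMap.inr K n n) = 0 :=
    linearMap_ext_lie (K := K) fun x y => by
      ext z
      have h : s ⁅((x, 0) : n × n), (y, 0)⁆ (0, z) = 0 := by
        rw [hs, LieAlgebra.Prod.bracket_apply, lie_zero, zero_lie]
        exact map_zero (s (x, 0))
      simpa using h
  have hα' : ∀ x y, s (x, 0) (y, 0) = α * killingForm K n x y := fun x y =>
    congrArg (fun f => f x y) hα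
  have hβ' : ∀ x y, s (0, x) (0, y) = β * killingForm K n x y := fun x y =>
    congrArg (fun f => f x y) hβ
  have hcross' : ∀ x y, s (x, 0) (0, y) = 0 := fun x y => congrArg (fun f => f x y) hcross
  have hform : ∀ x y : n × n,
      s x y = α * killingForm K n x.1 y.1 + β * killingForm K n x.2 y.2 := by
    rintro ⟨x, x'⟩ ⟨y, y'⟩
    have h1 : ((x, x') : n × n) = (x, 0) + (0, x') := by simp
    have h2 : ((y, y') : n × n) = (y, 0) + (0, y') := by simp
    rw [h1, h2]
    simp only [map_add, LinearMap.add_apply, hα', hβ', hcross', hss (0, x') (y, 0)]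
    simp
  have hdual : ∀ i, killingForm K n (b i) ((killingForm K n).dualBasis hκ b i) = 1 := fun i => by
    rw [LieModule.traceForm_comm]
    simp [LinearMap.BilinForm.apply_dualBasis_left]
  have hαβ : β = -α := by
    have : Nontrivial n := nontrivial_of_isSimple K n
    have h : ((finrank K n : ℕ) : K) * (α + β) = 0 := by
      rw [← hstr, Fintype.sum_sum_type]
      simp only [hform, double, Sum.elim_inl, Sum.elim_inr, hdual]
      simp
      ring
    have h2 := (mul_eq_zero.1 h).resolve_left (Nat.cast_ne_zero.2 finrank_pos.ne')
    linear_combination h2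
  refine ⟨α, fun x y => ?_⟩
  rw [hsP, hform, hαβ]
  change α * killingForm K n (φ x) (φ y) + -α * killingForm K n (ψ x) (ψ y) = _
  ring

end Prod

section Simple

variable {K g n : Type*} [Field K] [CharZero K] [LieRing g] [LieAlgebra K g] [Module.Finite K g]
  [LieRing n] [LieAlgebra K n] [Module.Finite K n]

/-- A Lie algebra with a nondegenerate Killing form is simple if its symmetric invariant bilinear
forms are proportional. -/
theorem isSimple_of_forall_eq_mul [IsKilling K g] [Nontrivial g]
    (h : ∀ P : g →ₗ[K] g →ₗ[K] K, (∀ x y z, P ⁅x, y⁆ z = P x ⁅y, z⁆) → (∀ x y, P x y = P y x) →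
      ∃ c : K, ∀ x y, P x y = c * killingForm K g x y) : IsSimple K g where
  non_abelian hab := not_subsingleton g
    ((IsKilling.isLieAbelian_iff_subsingleton K g).1 hab)
  eq_bot_or_eq_top I := by
    have hκ := IsKilling.killingForm_nondegenerate K g
    have hc := LieIdeal.isCompl_killingCompl (K := K) I
    have hc' : IsCompl I.toSubmodule (LieIdeal.killingCompl K g I).toSubmodule :=
      LieSubmodule.isCompl_toSubmodule.2 hc
    let π := Submodule.projection I.toSubmodule _ hc'
    have hπ : ∀ a ∈ I, ∀ b ∈ LieIdeal.killingCompl K g I, π (a + b) = a := fun a ha b hb => by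
      rw [map_add, Submodule.projection_apply_of_mem_left hc' ha,
        (Submodule.projection_apply_eq_zero_iff hc').2 hb, add_zero]
    have hdec : ∀ x, ∃ a ∈ I, ∃ b ∈ LieIdeal.killingCompl K g I, a + b = x := fun x =>
      ⟨π x, Submodule.projection_apply_mem hc' x, x - π x, Submodule.sub_projection_mem hc' x,
        add_sub_cancel _ _⟩
    have horth : ∀ a ∈ I, ∀ b ∈ LieIdeal.killingCompl K g I, killingForm K g a b = 0 :=
      fun a ha b hb => (LieIdeal.mem_killingCompl K g I).1 hb a ha
    have hinv : ∀ x y z, killingForm K g (π ⁅x, y⁆) z = killingForm K g (π x) ⁅y, z⁆ := by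
      intro x y z
      obtain ⟨a, ha, b, hb, rfl⟩ := hdec x
      rw [add_lie, hπ _ (lie_mem_left K g I a y ha) _ (lie_mem_left K g _ b y hb),
        hπ a ha b hb, LieModule.traceForm_apply_lie_apply]
    have hsymm : ∀ x y, killingForm K g (π x) y = killingForm K g (π y) x := by
      intro x y
      obtain ⟨a, ha, b, hb, rfl⟩ := hdec x
      obtain ⟨a', ha', b', hb', rfl⟩ := hdec y
      rw [hπ a ha b hb, hπ a' ha' b' hb', map_add, map_add, horth a ha b' hb',
        horth a' ha' b hb, LieModule.traceForm_comm]
    obtain ⟨c, hcπ⟩ := h (killingForm K g ∘ₗ π) hinv hsymm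
    have hπc : ∀ x, π x = c • x := fun x => by
      rw [← sub_eq_zero]
      refine hκ.1 _ fun y => ?_
      have := hcπ x y
      rw [LinearMap.comp_apply] at this
      rw [map_sub, LinearMap.sub_apply, this, map_smul, LinearMap.smul_apply, smul_eq_mul,
        sub_self]
    by_cases hc0 : c = 0
    · refine Or.inl ((LieSubmodule.eq_bot_iff I).2 fun a ha => ?_)
      have h1 := hπ a ha 0 (zero_mem _)
      rwa [hπc, hc0, zero_smul, eq_comm] at h1
    · refine Or.inr (eq_top_iff.2 fun x _ => ?_)
      have h1 : π x ∈ I := Submodule.projection_apply_mem hc' x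
      rw [hπc] at h1
      exact (Submodule.smul_mem_iff I.toSubmodule hc0).1 h1

theorem isSimple_and_nonempty_lieEquiv [IsKilling K g] [IsSimple K n] [IsAlgClosed K]
    (φ ψ : g →ₗ⁅K⁆ n) (σ : g ≃ₗ[K] n) (hσ : ∀ x, σ x = ψ x - φ x) :
    IsSimple K g ∧ Nonempty (g ≃ₗ⁅K⁆ n) := by
  have : Nontrivial n := nontrivial_of_isSimple K n
  have : Nontrivial g := σ.toEquiv.nontrivial
  have hκ := IsKilling.killingForm_nondegenerate K g
  have hκi : ∀ x y z : g, killingForm K g ⁅x, y⁆ z = killingForm K g x ⁅y, z⁆ :=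
    LieModule.traceForm_apply_lie_apply K g g
  obtain ⟨c, hc⟩ := exists_smul_eq φ ψ σ hσ (killingForm K g) hκi
    (LieModule.traceForm_comm K g g)
  have hc0 : c ≠ 0 := by
    rintro rfl
    obtain ⟨x, hx⟩ := exists_ne (0 : g)
    exact hx (hκ.1 x fun y => by simpa using hc x y)
  have hs : IsSimple K g := isSimple_of_forall_eq_mul fun P hP hPs => by
    obtain ⟨d, hd⟩ := exists_smul_eq φ ψ σ hσ P hP hPs
    refine ⟨d / c, fun x y => ?_⟩
    have h1 := hc x y
    have h2 := hd x y
    have h3 : (2 : K) ≠ 0 := two_ne_zero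
    field_simp
    apply mul_left_cancel₀ h3
    linear_combination c * h2 - d * h1
  refine ⟨hs, ?_⟩
  rcases IsSimple.eq_bot_or_eq_top (R := K) φ.ker with h | h
  · have hi : Function.Injective (φ : g →ₗ[K] n) := (LieHom.ker_eq_bot φ).1 h
    exact ⟨LieEquiv.ofBijective φ ⟨hi,
      (LinearMap.injective_iff_surjective_of_finrank_eq_finrank σ.finrank_eq).1 hi⟩⟩
  · have h0 : ∀ x, ψ x = σ x := fun x => by
      have hx : x ∈ φ.ker := h ▸ LieSubmodule.mem_top x
      rw [hσ, (LieHom.mem_ker (f := φ)).1 hx, sub_zero]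
    exact ⟨LieEquiv.ofBijective ψ (by rw [show (ψ : g → n) = σ from funext h0]; exact σ.bijective)⟩

end Simple

section Bridge

variable {K V : Type*} [Field K] [CharZero K] [AddCommGroup V] [Module K V]

/-- The Lie algebra with a given bracket. -/
def OfBracket {b : V → V → V} (_ : IsLieBr K b) : Type _ := V

namespace OfBracket

variable {b : V → V → V} (h : IsLieBr K b)

instance : AddCommGroup (OfBracket h) := inferInstanceAs (AddCommGroup V)

instance : Module K (OfBracket h) := inferInstanceAs (Module K V)

instance [Module.Finite K V] : Module.Finite K (OfBracket h) :=
  inferInstanceAs (Module.Finite K V)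

instance : LieRing (OfBracket h) where
  bracket := b
  add_lie x y z := (h.2.1 z).map_add x y
  lie_add x := (h.1 x).map_add
  lie_self := h.2.2.1
  leibniz_lie := h.2.2.2

instance : LieAlgebra K (OfBracket h) where
  lie_smul c x y := (h.1 x).map_smul c y

theorem isSimple_iff : IsSimple K (OfBracket h) ↔ IsSimpleBr K b := by
  constructor
  · intro hs
    refine ⟨?_, fun I hI => ?_⟩
    · by_contra! hab
      exact hs.non_abelian ⟨hab⟩
    · let J : LieIdeal K (OfBracket h) := { (I : Submodule K V) with lie_mem := fun {x m} => hI x m }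
      rcases hs.eq_bot_or_eq_top J with hJ | hJ
      · exact Or.inl (congrArg LieSubmodule.toSubmodule hJ)
      · exact Or.inr (congrArg LieSubmodule.toSubmodule hJ)
  · rintro ⟨⟨x, y, hxy⟩, hI⟩
    refine ⟨fun I => ?_, fun hab => hxy (hab.trivial x y)⟩
    rcases hI I.toSubmodule fun x y hy => I.lie_mem hy with hI | hI
    · exact Or.inl (LieSubmodule.toSubmodule_injective hI)
    · exact Or.inr (LieSubmodule.toSubmodule_injective hI)

/-- A subspace of the Lie algebra with bracket `b`, as a subspace of `V`. -/
def toSubmodule (I : LieIdeal K (OfBracket h)) : Submodule K V := I.toSubmodule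

theorem derSeriesFrom_toSubmodule (I : LieIdeal K (OfBracket h)) (k : ℕ) :
    derSeriesFrom K b (toSubmodule h I) k =
      toSubmodule h (derivedSeriesOfIdeal K (OfBracket h) k I) := by
  induction k with
  | zero => rfl
  | succ k ih =>
    rw [derSeriesFrom.eq_def]
    simp only [ih]
    have hspan : Submodule.span K {z : OfBracket h | ∃ x ∈ derivedSeriesOfIdeal K (OfBracket h) k I,
        ∃ y ∈ derivedSeriesOfIdeal K (OfBracket h) k I, ⁅x, y⁆ = z} =
        (derivedSeriesOfIdeal K (OfBracket h) (k + 1) I).toSubmodule := by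
      rw [derivedSeriesOfIdeal_succ, LieSubmodule.lieIdeal_oper_eq_linear_span']
    refine Eq.trans ?_ hspan
    congr 1
    ext z
    constructor <;>
    · rintro ⟨x, hx, y, hy, rfl⟩
      exact ⟨x, hx, y, hy, rfl⟩

theorem hasTrivialRadical (hs : IsSemisimpleBr K b) : HasTrivialRadical K (OfBracket h) := by
  refine hasTrivialRadical_of_no_solvable_ideals fun I hI => ?_
  obtain ⟨k, hk⟩ := (isSolvable_iff K I).1 hI
  rw [LieIdeal.derivedSeries_eq_bot_iff] at hk
  exact LieSubmodule.toSubmodule_injective (hs (toSubmodule h I) (fun x y hy => I.lie_mem hy)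
    ⟨k, (derSeriesFrom_toSubmodule h I k).trans (congrArg (toSubmodule h) hk)⟩)

end OfBracket

/-- Left multiplications of a post-Lie algebra structure are inner derivations. -/
theorem exists_postLie_eq_ad [Module.Finite K V] {gb nb mul : V → V → V} (hg : IsLieBr K gb)
    (hn : IsLieBr K nb) [IsKilling K (OfBracket hn)] (hpl : IsPostLie K gb nb mul) :
    ∃ φ : OfBracket hg →ₗ⁅K⁆ OfBracket hn, ∀ x y, mul x y = nb (φ x) y := by
  obtain ⟨h1, h2, h3, h4, h5⟩ := hpl
  have hex : ∀ x, ∃ a : V, ∀ y, mul x y = nb a y := by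
    intro x
    let D : LieDerivation K (OfBracket hn) (OfBracket hn) :=
      { toLinearMap := (h1 x).mk' (mul x)
        leibniz' := fun a c => by
          rw [← lie_skew c, sub_neg_eq_add, add_comm]
          exact h5 x a c }
    obtain ⟨a, ha⟩ := LieDerivation.IsKilling.exists_eq_ad D
    refine ⟨a, fun y => ?_⟩
    have h : LieDerivation.ad K (OfBracket hn) a y = D y := congrArg (fun E => E y) ha
    exact h.symm.trans (LieDerivation.ad_apply_apply K (OfBracket hn) a y)
  choose f hf using hex
  have hinj : ∀ a c : OfBracket hn, (∀ y : OfBracket hn, ⁅a, y⁆ = ⁅c, y⁆) → a = c := by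
    intro a c hac
    have h : a - c ∈ LieAlgebra.center K (OfBracket hn) := fun y => by
      rw [← lie_skew, sub_lie, hac y, sub_self, neg_zero]
    rw [center_eq_bot] at h
    exact sub_eq_zero.1 h
  let F : OfBracket hg → OfBracket hn := f
  have hF : ∀ x (y : OfBracket hn), ⁅F x, y⁆ = mul x y := fun x y => (hf x y).symm
  refine ⟨{ toFun := F, map_add' := ?_, map_smul' := ?_, map_lie' := ?_ }, hf⟩
  · intro x y
    refine hinj _ _ fun z => ?_
    rw [add_lie, hF, hF, hF]
    exact (h2 z).map_add x y
  · intro c x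
    refine hinj _ _ fun z => ?_
    rw [smul_lie, hF, RingHom.id_apply, hF]
    exact (h2 z).map_smul c x
  · intro x y
    refine hinj _ _ fun z => ?_
    rw [lie_lie, hF, hF, hF, hF, hF]
    exact h4 x y z

end Bridge

end PostLie

open PostLie in
theorem postLie_simple_n_semisimple_g {V : Type*} [AddCommGroup V] [Module ℂ V]
    [FiniteDimensional ℂ V]
    (gb nb : V → V → V) (hg : IsLieBr ℂ gb) (hn : IsLieBr ℂ nb)
    (hnsimple : IsSimpleBr ℂ nb) (hgss : IsSemisimpleBr ℂ gb)
    (mul : V → V → V) (hpl : IsPostLie ℂ gb nb mul) :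
    IsSimpleBr ℂ gb ∧ LieBrIso ℂ gb nb := by
  have : LieAlgebra.HasTrivialRadical ℂ (OfBracket hg) := OfBracket.hasTrivialRadical hg hgss
  have : LieAlgebra.IsSimple ℂ (OfBracket hn) := (OfBracket.isSimple_iff hn).2 hnsimple
  obtain ⟨φ, hφ⟩ := exists_postLie_eq_ad hg hn hpl
  let σ : OfBracket hg ≃ₗ[ℂ] OfBracket hn := LinearEquiv.refl ℂ V
  have hbr : ∀ x y : OfBracket hg,
      σ ⁅x, y⁆ = ⁅φ x, σ y⁆ - ⁅φ y, σ x⁆ + ⁅σ x, σ y⁆ := by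
    intro x y
    exact sub_eq_iff_eq_add.1 ((hpl.2.2.1 x y).symm.trans (congrArg₂ (· - ·) (hφ x y) (hφ y x)))
  let ψ : OfBracket hg →ₗ⁅ℂ⁆ OfBracket hn :=
    { toLinearMap := (φ : OfBracket hg →ₗ[ℂ] OfBracket hn) + σ.toLinearMap
      map_lie' := by
        intro x y
        change φ ⁅x, y⁆ + σ ⁅x, y⁆ = ⁅φ x + σ x, φ y + σ y⁆
        rw [hbr, LieHom.map_lie, add_lie, lie_add, lie_add, ← lie_skew (σ x) (φ y)]
        abel }
  obtain ⟨hs, ⟨e⟩⟩ := isSimple_and_nonempty_lieEquiv φ ψ σ fun x => by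
    change σ x = φ x + σ x - φ x
    abel
  exact ⟨(OfBracket.isSimple_iff hg).1 hs, e.toLinearEquiv, e.map_lie⟩
end
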